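/- arXiv:1512.00962 — 2 statements merged into one kernel-verified Lean document; each statement's English description precedes it below -/
import Mathlib

section
/- For every prime power q with q ≡ 3 (mod 4), there exists a set M of one-dimensional F_q-subspaces of F_{q^6}, each contained in the zero set of Q, such that |M| = (q+1)(q^3+1)/2 and every two-dimensional F_q-subspace of F_{q^6} on which Q vanishes identically contains exactly (q+1)/2 members of M. (Equivalently, by duality this yields a hemisystem of the Hermitian surface H(3,q^2), i.e. Theorem 1.1 in its dual formulation as a (q+1)/2-ovoid of the elliptic quadric Q^-(5,q).) -/
open scoped Classical

namespace Hemisystem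

open Module

section Squares

variable {F : Type*} [Field F] [Fintype F]

lemma isSquare_mul_of_not_isSquare {a b : F} (ha : ¬IsSquare a) (hb : ¬IsSquare b) :
    IsSquare (a * b) := by
  by_cases hab : a * b = 0
  · rw [hab]; exact IsSquare.zero
  rw [← quadraticChar_one_iff_isSquare hab, map_mul,
    quadraticChar_neg_one_iff_not_isSquare.2 ha, quadraticChar_neg_one_iff_not_isSquare.2 hb]
  norm_num

omit [Fintype F] in
lemma isSquare_mul_iff_of_isSquare {a b : F} (ha : IsSquare a) (ha0 : a ≠ 0) :
    IsSquare (a * b) ↔ IsSquare b := by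
  refine ⟨fun h => ?_, fun h => ha.mul h⟩
  have := h.div ha
  rwa [mul_div_cancel_left₀ _ ha0] at this

lemma isSquare_mul_iff_of_not_isSquare {a b : F} (ha : ¬IsSquare a) (hb : b ≠ 0) :
    IsSquare (a * b) ↔ ¬IsSquare b :=
  ⟨fun h hb' => ha ((isSquare_mul_iff_of_isSquare hb' hb).1 (mul_comm a b ▸ h)),
    isSquare_mul_of_not_isSquare ha⟩

lemma isSquare_iff_not_of_not_isSquare_mul {a b : F} (h : ¬IsSquare (a * b)) :
    IsSquare b ↔ ¬IsSquare a :=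
  ⟨fun hb ha => h (ha.mul hb), fun ha => by
    by_contra hb; exact h (isSquare_mul_of_not_isSquare ha hb)⟩

lemma exists_sq_add_mul_sq (hF : Fintype.card F % 2 = 1) {c : F} (hc : c ≠ 0) :
    ∃ r s : F, r * r + c * (s * s) = -1 := by
  open Polynomial in
  obtain ⟨r, s, h⟩ := FiniteField.exists_root_sum_quadratic (R := F)
    (f := X ^ 2 + C 1) (g := C c * X ^ 2) (degree_X_pow_add_C (by norm_num) _)
    (degree_C_mul_X_pow 2 hc) hF
  refine ⟨r, s, ?_⟩
  simp at h
  linear_combination h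

end Squares

variable {K L : Type*} [Field K] [Field L] [Algebra K L]

/-- The data of a cyclic sextic extension with generator `σ`, together with a square root `i` of
`-1` and an element `d` of norm `-1` in its quadratic subfield. -/
structure Frame (σ : L →ₐ[K] L) (i d : L) : Prop where
  fixed : ∀ x, σ x = x → ∃ k, algebraMap K L k = x
  six : ∀ x, σ (σ (σ (σ (σ (σ x))))) = x
  i_mul : i * i = -1
  map_i : σ i = -i
  map_map_d : σ (σ d) = d
  d_mul : d * σ d = -1
  neg_one : ¬IsSquare (-1 : K)

/-- The trace form of `L` over the fixed field of `σ ^ 2`. -/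
def tform (σ : L →ₐ[K] L) (x y : L) : L :=
  x * y + σ (σ x) * σ (σ y) + σ (σ (σ (σ x))) * σ (σ (σ (σ y)))

/-- The quadratic form whose values on singular vectors lie in `K`. -/
def rform (σ : L →ₐ[K] L) (i d x y : L) : L := i * σ d * tform σ x y

/-- Singularity for the quadric in trace coordinates. -/
def Sing (σ : L →ₐ[K] L) (i d x : L) : Prop := σ (rform σ i d x x) = rform σ i d x x

/-- The spinor coordinate. -/
def spin (σ : L →ₐ[K] L) (i x : L) : L := x + i * σ (σ x)

/-- Half of the singular vectors. -/
def Good (σ : L →ₐ[K] L) (i d x : L) : Prop :=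
  (tform σ x x = 0 ∧ IsSquare (spin σ i x)) ∨
    ∃ k : K, k ≠ 0 ∧ rform σ i d x x = algebraMap K L (k * k)

lemma tform_comm (σ : L →ₐ[K] L) (x y : L) : tform σ x y = tform σ y x := by
  simp only [tform]; ring

lemma rform_comm (σ : L →ₐ[K] L) (i d x y : L) : rform σ i d x y = rform σ i d y x := by
  rw [rform, tform_comm, rform]

lemma rform_comb (σ : L →ₐ[K] L) (i d x y : L) (a b c e : K) :
    rform σ i d (a • x + b • y) (c • x + e • y) =
      algebraMap K L (a * c) * rform σ i d x x +
      algebraMap K L (a * e + b * c) * rform σ i d x y +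
      algebraMap K L (b * e) * rform σ i d y y := by
  simp only [rform, tform, Algebra.smul_def, map_add, map_mul, AlgHom.commutes]
  ring

lemma spin_smul (σ : L →ₐ[K] L) (i x : L) (a : K) :
    spin σ i (a • x) = algebraMap K L a * spin σ i x := by
  simp only [spin, Algebra.smul_def, map_mul, AlgHom.commutes]; ring

namespace Frame

variable {σ : L →ₐ[K] L} {i d : L} (h : Frame σ i d)
include h

lemma i_ne_zero : i ≠ 0 := by
  rintro rfl; simpa using h.i_mul

lemma d_ne_zero : d ≠ 0 := by
  rintro rfl; simpa using h.d_mul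

lemma map_d_ne_zero : σ d ≠ 0 := by
  intro h0; simpa [h0] using h.d_mul

lemma two_ne_zero : (2 : L) ≠ 0 := by
  intro h2
  apply h.neg_one
  refine ⟨1, (algebraMap K L).injective ?_⟩
  simp only [map_neg, map_one, mul_one]
  linear_combination -h2

lemma rform_eq_zero_iff {x y : L} : rform σ i d x y = 0 ↔ tform σ x y = 0 := by
  simp [rform, h.i_ne_zero, h.map_d_ne_zero]

lemma not_isSquare_of_mul_map {e : L} {k : K} (hk : k ≠ 0) (he : σ (σ e) = e)
    (hek : e * σ e = -algebraMap K L (k * k)) : ¬IsSquare e := by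
  rintro ⟨w, rfl⟩
  obtain ⟨n, hn⟩ := h.fixed
    (w * σ w * σ (σ w) * σ (σ (σ w)) * σ (σ (σ (σ w))) * σ (σ (σ (σ (σ w)))))
    (by simp only [map_mul, h.six]; ring)
  have he' := congrArg (fun z => σ (σ z)) he
  simp only [map_mul] at he he' hek
  have hn2 : algebraMap K L (n * n) = algebraMap K L (-(k ^ 3 * k ^ 3)) := by
    have e1 := congrArg σ he
    have e2 := congrArg σ he'
    simp only [map_mul] at e1 e2
    have : algebraMap K L (n * n) = (w * w * (σ w * σ w)) * (w * w * (σ w * σ w))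
        * (w * w * (σ w * σ w)) := by
      rw [map_mul, hn]
      calc _ = (w * w) * (σ w * σ w) * (σ (σ w) * σ (σ w)) * (σ (σ (σ w)) * σ (σ (σ w)))
          * (σ (σ (σ (σ w))) * σ (σ (σ (σ w))))
          * (σ (σ (σ (σ (σ w)))) * σ (σ (σ (σ (σ w))))) := by ring
        _ = _ := by rw [e2, he', e1, he]; ring
    rw [this, hek]
    simp only [map_mul, map_neg, map_pow]
    ring
  have hn3 := (algebraMap K L).injective hn2
  refine h.neg_one ⟨n / k ^ 3, ?_⟩
  field_simp
  linear_combination -hn3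

lemma not_isSquare_d : ¬IsSquare d :=
  h.not_isSquare_of_mul_map (k := 1) one_ne_zero h.map_map_d (by simp [h.d_mul])

lemma not_isSquare_of_rform {x y : L} {k : K} (hk : k ≠ 0)
    (hxy : rform σ i d x y = algebraMap K L k) : ¬IsSquare (tform σ x y) := by
  unfold rform at hxy
  have h1 := congrArg σ hxy
  have h2 := congrArg σ h1
  simp only [map_mul, h.map_i, h.map_map_d, AlgHom.commutes, map_neg, neg_neg] at h1 h2
  refine h.not_isSquare_of_mul_map hk ?_ ?_
  · have : i * σ d ≠ 0 := mul_ne_zero h.i_ne_zero h.map_d_ne_zero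
    apply mul_left_cancel₀ this
    rw [hxy, h2]
  · rw [map_mul]
    nth_rewrite 1 [← hxy]
    rw [← h1]
    linear_combination (-tform σ x y * σ (tform σ x y)) * (h.i_mul) * d * σ d +
      (tform σ x y * σ (tform σ x y)) * h.d_mul

lemma isSquare_algebraMap [Fintype K] (k : K) : IsSquare (algebraMap K L k) := by
  by_cases hk : IsSquare k
  · exact hk.map _
  · obtain ⟨r, hr⟩ := isSquare_mul_of_not_isSquare h.neg_one hk
    refine ⟨i * algebraMap K L r, ?_⟩
    have := congrArg (algebraMap K L) hr
    simp only [map_mul, map_neg, map_one] at this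
    linear_combination -this - algebraMap K L r * algebraMap K L r * h.i_mul

lemma sing_iff {x : L} : Sing σ i d x ↔ ∃ k, rform σ i d x x = algebraMap K L k :=
  ⟨fun hx => (h.fixed _ hx).imp fun _ => Eq.symm, fun ⟨k, hk⟩ => by
    rw [Sing, hk, AlgHom.commutes]⟩

lemma spin_mul_conj {x : L} : spin σ i x * (x - i * σ (σ x)) =
    tform σ x x - σ (σ (σ (σ x))) * σ (σ (σ (σ x))) := by
  simp only [spin, tform]
  linear_combination -σ (σ x) * σ (σ x) * h.i_mul

lemma spin_ne_zero {x : L} (hx : x ≠ 0) (hxx : tform σ x x = 0) : spin σ i x ≠ 0 := by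
  intro h0
  have := h.spin_mul_conj (x := x)
  rw [h0, hxx] at this
  simp [hx] at this

/-- The trace form takes square values on vectors orthogonal to a singular vector. -/
lemma isSquare_of_orthogonal {x y : L} (hx : x ≠ 0) (hxx : tform σ x x = 0)
    (hxy : tform σ x y = 0) : IsSquare (tform σ y y) := by
  have hp := h.spin_ne_zero hx hxx
  refine ⟨(σ (σ (σ (σ x))) * spin σ i y - spin σ i x * σ (σ (σ (σ y)))) / spin σ i x, ?_⟩
  field_simp
  have h1 := h.spin_mul_conj (x := x)
  have h2 := h.spin_mul_conj (x := y)
  have h3 : spin σ i x * (y - i * σ (σ y)) + spin σ i y * (x - i * σ (σ x)) =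
      2 * (tform σ x y - σ (σ (σ (σ x))) * σ (σ (σ (σ y)))) := by
    simp only [spin, tform]
    linear_combination -2 * σ (σ x) * σ (σ y) * h.i_mul
  rw [hxx] at h1
  rw [hxy] at h3
  linear_combination (-spin σ i x ^ 2) * h2 + (spin σ i x * spin σ i y) * h3
    - spin σ i y ^ 2 * h1

lemma tform_mul_spin {x y : L} (hxx : tform σ x x = 0) (hyy : tform σ y y = 0) :
    2 * tform σ x y * (spin σ i x * spin σ i y) =
      -(spin σ i x * σ (σ (σ (σ y))) - spin σ i y * σ (σ (σ (σ x)))) ^ 2 := by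
  have h1 := h.spin_mul_conj (x := x)
  have h2 := h.spin_mul_conj (x := y)
  have h3 : spin σ i x * (y - i * σ (σ y)) + spin σ i y * (x - i * σ (σ x)) =
      2 * (tform σ x y - σ (σ (σ (σ x))) * σ (σ (σ (σ y)))) := by
    simp only [spin, tform]
    linear_combination -2 * σ (σ x) * σ (σ y) * h.i_mul
  rw [hxx] at h1
  rw [hyy] at h2
  linear_combination (-spin σ i x * spin σ i y) * h3 + spin σ i x ^ 2 * h2 + spin σ i y ^ 2 * h1

/-- Orthogonal singular vectors are proportional over the fixed field of `σ ^ 2`. -/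
lemma map_map_div_of_orthogonal {x y : L} (hx : x ≠ 0) (hxx : tform σ x x = 0)
    (hyy : tform σ y y = 0) (hxy : tform σ x y = 0) : σ (σ (y / x)) = y / x := by
  have hp := h.spin_ne_zero hx hxx
  have hsq := h.tform_mul_spin hxx hyy
  rw [hxy] at hsq
  have hlin : spin σ i x * σ (σ (σ (σ y))) = spin σ i y * σ (σ (σ (σ x))) := by
    have : (spin σ i x * σ (σ (σ (σ y))) - spin σ i y * σ (σ (σ (σ x)))) ^ 2 = 0 := by
      linear_combination hsq
    exact sub_eq_zero.1 (pow_eq_zero_iff (by norm_num) |>.1 this)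
  have h1 := h.spin_mul_conj (x := x)
  have h2 := h.spin_mul_conj (x := y)
  have h3 : spin σ i x * (y - i * σ (σ y)) + spin σ i y * (x - i * σ (σ x)) =
      2 * (tform σ x y - σ (σ (σ (σ x))) * σ (σ (σ (σ y)))) := by
    simp only [spin, tform]
    linear_combination -2 * σ (σ x) * σ (σ y) * h.i_mul
  rw [hxx] at h1
  rw [hxy] at h3
  have hconj : spin σ i x * (y - i * σ (σ y)) = spin σ i y * (x - i * σ (σ x)) := by
    apply mul_left_cancel₀ hp
    linear_combination spin σ i x * h3 - 2 * spin σ i y * h1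
      - 2 * σ (σ (σ (σ x))) * hlin
  have hy0 : spin σ i x * y = spin σ i y * x := by
    apply mul_left_cancel₀ h.two_ne_zero
    have hs : ∀ z, 2 * z = spin σ i z + (z - i * σ (σ z)) := fun z => by
      simp only [spin]; ring
    linear_combination spin σ i x * hs y - spin σ i y * hs x + hconj
  have hy1 : spin σ i x * σ (σ y) = spin σ i y * σ (σ x) := by
    have : (2 * i) ≠ 0 := mul_ne_zero h.two_ne_zero h.i_ne_zero
    apply mul_left_cancel₀ this
    have hs : ∀ z, 2 * i * σ (σ z) = spin σ i z - (z - i * σ (σ z)) := fun z => by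
      simp only [spin]; ring
    linear_combination spin σ i x * hs y - spin σ i y * hs x - hconj
  have hx2 : σ (σ x) ≠ 0 := by simpa using hx
  rw [map_div₀, map_div₀, div_eq_div_iff hx2 hx]
  apply mul_left_cancel₀ hp
  linear_combination x * hy1 - σ (σ x) * hy0

lemma good_smul {x : L} (hx : Good σ i d x) {a : K} (ha : a ≠ 0) [Fintype K] :
    Good σ i d (a • x) := by
  have hcomb := rform_comb σ i d x x a 0 a 0
  simp only [zero_smul, add_zero, mul_zero, zero_mul, map_zero] at hcomb
  rcases hx with ⟨h0, hs⟩ | ⟨k, hk, hr⟩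
  · refine Or.inl ⟨?_, ?_⟩
    · rw [← h.rform_eq_zero_iff, hcomb, h.rform_eq_zero_iff.2 h0, mul_zero]
    · rw [spin_smul]; exact (h.isSquare_algebraMap a).mul hs
  · refine Or.inr ⟨a * k, mul_ne_zero ha hk, ?_⟩
    rw [hcomb, hr, ← map_mul]; congr 1; ring

lemma good_iff_spin {x : L} (hxx : tform σ x x = 0) :
    Good σ i d x ↔ IsSquare (spin σ i x) := by
  refine ⟨?_, fun hs => Or.inl ⟨hxx, hs⟩⟩
  rintro (⟨-, hs⟩ | ⟨k, hk, hr⟩)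
  · exact hs
  · rw [h.rform_eq_zero_iff.2 hxx] at hr
    simp [hk] at hr

lemma good_iff_isSquare {x : L} {k : K} (hk : k ≠ 0) (hxx : rform σ i d x x = algebraMap K L k) :
    Good σ i d x ↔ IsSquare k := by
  constructor
  · rintro (⟨h0, -⟩ | ⟨l, hl, hr⟩)
    · rw [h.rform_eq_zero_iff.2 h0] at hxx
      exact absurd ((map_eq_zero _).1 hxx.symm) hk
    · exact ⟨l, (algebraMap K L).injective (hxx.symm.trans hr)⟩
  · rintro ⟨l, rfl⟩
    exact Or.inr ⟨l, fun h0 => hk (by simp [h0]), hxx⟩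

lemma good_iff_of_rform_neg [Fintype K] {x y : L} {k : K} (hk : k ≠ 0)
    (hxx : rform σ i d x x = algebraMap K L k) (hyy : rform σ i d y y = algebraMap K L (-k)) :
    Good σ i d y ↔ ¬Good σ i d x := by
  rw [h.good_iff_isSquare hk hxx, h.good_iff_isSquare (neg_ne_zero.2 hk) hyy, ← neg_one_mul]
  exact isSquare_mul_iff_of_not_isSquare h.neg_one hk

lemma good_iff_of_spin [Fintype L] {x y : L} (hxx : tform σ x x = 0) (hyy : tform σ y y = 0)
    (hs : ¬IsSquare (spin σ i x * spin σ i y)) : Good σ i d y ↔ ¬Good σ i d x := by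
  rw [h.good_iff_spin hxx, h.good_iff_spin hyy]
  exact isSquare_iff_not_of_not_isSquare_mul hs

lemma good_iff_of_rform [Fintype K] [Fintype L] {x y : L} (hx : x ≠ 0) (hy : y ≠ 0)
    (hxx : tform σ x x = 0) (hyy : tform σ y y = 0) {k : K} (hk : k ≠ 0)
    (hxy : rform σ i d x y = algebraMap K L k) : Good σ i d y ↔ ¬Good σ i d x := by
  apply h.good_iff_of_spin hxx hyy
  intro hs
  have hp : spin σ i x * spin σ i y ≠ 0 :=
    mul_ne_zero (h.spin_ne_zero hx hxx) (h.spin_ne_zero hy hyy)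
  have h2 : IsSquare (-2 : L) := by
    simpa only [map_neg, map_ofNat] using h.isSquare_algebraMap (-2 : K)
  apply h.not_isSquare_of_rform hk hxy
  rw [← isSquare_mul_iff_of_isSquare h2 (neg_ne_zero.2 h.two_ne_zero),
    ← isSquare_mul_iff_of_isSquare hs hp]
  refine ⟨spin σ i x * σ (σ (σ (σ y))) - spin σ i y * σ (σ (σ (σ x))), ?_⟩
  linear_combination -h.tform_mul_spin hxx hyy

lemma tform_d_mul (x y : L) : tform σ (d * x) (d * y) = d * d * tform σ x y := by
  simp only [tform, map_mul, h.map_map_d]; ring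

lemma spin_d_mul (x : L) : spin σ i (d * x) = d * spin σ i x := by
  simp only [spin, map_mul, h.map_map_d]; ring

lemma rform_i_mul (x y : L) : rform σ i d (i * x) (i * y) = -rform σ i d x y := by
  simp only [rform, tform, map_mul, h.map_i, map_neg]
  linear_combination i * σ d * (x * y + σ (σ x) * σ (σ y) +
    σ (σ (σ (σ x))) * σ (σ (σ (σ y)))) * h.i_mul

lemma good_d_mul [Fintype L] {x : L} (hx : x ≠ 0) (hxx : tform σ x x = 0) :
    Good σ i d (d * x) ↔ ¬Good σ i d x := by
  rw [h.good_iff_spin hxx, h.good_iff_spin (by rw [h.tform_d_mul, hxx, mul_zero]), h.spin_d_mul]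
  exact isSquare_mul_iff_of_not_isSquare h.not_isSquare_d (h.spin_ne_zero hx hxx)

lemma good_i_mul [Fintype K] {x : L} (hs : Sing σ i d x) (hxx : tform σ x x ≠ 0) :
    Good σ i d (i * x) ↔ ¬Good σ i d x := by
  obtain ⟨k, hk⟩ := h.sing_iff.1 hs
  refine h.good_iff_of_rform_neg (k := k) ?_ hk ?_
  · rintro rfl
    rw [map_zero, h.rform_eq_zero_iff] at hk
    exact hxx hk
  · rw [h.rform_i_mul, hk, map_neg]

/-- The good singular vectors are exchanged with the other ones by an injective map. -/
lemma exists_flip_sing [Fintype K] [Fintype L] : ∃ g : L → L,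
    Set.InjOn g {x | x ≠ 0 ∧ Sing σ i d x} ∧
    ∀ x, x ≠ 0 → Sing σ i d x →
      g x ≠ 0 ∧ Sing σ i d (g x) ∧ (Good σ i d (g x) ↔ ¬Good σ i d x) := by
  have key : ∀ x, tform σ (i * x) (i * x) = 0 ↔ tform σ x x = 0 := fun x => by
    rw [← h.rform_eq_zero_iff, h.rform_i_mul, neg_eq_zero, h.rform_eq_zero_iff]
  have key' : ∀ x, tform σ (d * x) (d * x) = 0 ↔ tform σ x x = 0 := fun x => by
    simp [h.tform_d_mul, h.d_ne_zero]
  refine ⟨fun x => if tform σ x x = 0 then d * x else i * x, ?_, ?_⟩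
  · intro x _ y _ hxy
    dsimp only at hxy
    split_ifs at hxy with h1 h2 h2
    · exact mul_left_cancel₀ h.d_ne_zero hxy
    · rw [← key', hxy, key] at h1; exact absurd h1 h2
    · rw [← key', ← hxy, key] at h2; exact absurd h2 h1
    · exact mul_left_cancel₀ h.i_ne_zero hxy
  · intro x hx hs
    dsimp only
    split_ifs with h1
    · refine ⟨mul_ne_zero h.d_ne_zero hx, ?_, h.good_d_mul hx h1⟩
      rw [Sing, h.rform_eq_zero_iff.2 ((key' x).2 h1), map_zero]
    · refine ⟨mul_ne_zero h.i_ne_zero hx, ?_, h.good_i_mul hs h1⟩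
      rw [Sing] at hs ⊢
      rw [h.rform_i_mul, map_neg, hs]

lemma exists_eq_add_mul {c e : L} (hc : σ (σ c) = c) (hcσ : σ c ≠ c) (he : σ (σ e) = e) :
    ∃ r s : K, e = algebraMap K L r + algebraMap K L s * c := by
  have hne : c - σ c ≠ 0 := sub_ne_zero.2 hcσ.symm
  obtain ⟨s, hs⟩ := h.fixed ((e - σ e) / (c - σ c)) (by
    rw [map_div₀, map_sub, map_sub, hc, he, ← neg_sub c, ← neg_sub e, neg_div_neg_eq])
  have hs' : algebraMap K L s * (c - σ c) = e - σ e := by rw [hs]; field_simp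
  obtain ⟨r, hr⟩ := h.fixed (e - algebraMap K L s * c) (by
    rw [map_sub, map_mul, AlgHom.commutes]; linear_combination hs')
  exact ⟨r, s, by rw [hr]; ring⟩

lemma mem_range_of_sing {x y : L} (hx : Sing σ i d x) (hy : Sing σ i d y)
    (hxy : Sing σ i d (x + y)) : ∃ k, rform σ i d x y = algebraMap K L k := by
  apply (h.fixed _ _).imp fun _ => Eq.symm
  have hcomb := rform_comb σ i d x y 1 1 1 1
  simp only [one_smul, mul_one, map_one, one_mul, map_add] at hcomb
  unfold Sing at hx hy hxy
  rw [hcomb] at hxy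
  simp only [map_add, map_mul, hx, hy, map_one] at hxy
  apply mul_left_cancel₀ h.two_ne_zero
  linear_combination hxy

end Frame

lemma exists_basis_of_finrank_two {W : Submodule K L} (hW : finrank K W = 2) {x : L}
    (hx : x ≠ 0) (hxW : x ∈ W) :
    ∃ y ∈ W, LinearIndependent K ![x, y] ∧ ∀ z ∈ W, ∃ a b : K, z = a • x + b • y := by
  have hfin : FiniteDimensional K W := FiniteDimensional.of_finrank_pos (by omega)
  have hlt : ∃ y ∈ W, y ∉ K ∙ x := by
    by_contra! hcon
    have h1 := Submodule.finrank_mono (R := K) (show W ≤ K ∙ x from hcon)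
    rw [hW, finrank_span_singleton hx] at h1
    omega
  obtain ⟨y, hyW, hy⟩ := hlt
  have hli : LinearIndependent K ![x, y] := by
    rw [LinearIndependent.pair_iff' hx]
    intro a ha
    exact hy (Submodule.mem_span_singleton.2 ⟨a, ha⟩)
  refine ⟨y, hyW, hli, fun z hz => ?_⟩
  have hle : Submodule.span K (Set.range ![x, y]) ≤ W := by
    rw [Submodule.span_le]
    rintro _ ⟨j, rfl⟩
    fin_cases j
    · exact hxW
    · exact hyW
  have heq := Submodule.eq_of_le_of_finrank_eq hle (by
    rw [finrank_span_eq_card hli, hW]; simp)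
  rw [← heq, Matrix.range_cons_cons_empty, Submodule.mem_span_pair] at hz
  obtain ⟨a, b, hab⟩ := hz
  exact ⟨a, b, hab.symm⟩

/-- A binary form with values `ρ * (a * a + c * (b * b))` in an orthogonal basis has a similarity
of multiplier `-1` without singular eigenvectors. -/
lemma Frame.exists_flip_of_orthogonal [Fintype K] [Fintype L] {σ : L →ₐ[K] L} {i d : L}
    (h : Frame σ i d) (hK : Fintype.card K % 2 = 1) {W : Submodule K L} {x y : L} {ρ c : K}
    (hx : x ∈ W) (hy : y ∈ W) (hli : LinearIndependent K ![x, y])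
    (hspan : ∀ z ∈ W, ∃ a b : K, z = a • x + b • y) (hρ : ρ ≠ 0) (hc : c ≠ 0)
    (hxx : rform σ i d x x = algebraMap K L ρ) (hxy : rform σ i d x y = 0)
    (hyy : rform σ i d y y = algebraMap K L (ρ * c)) :
    ∃ g : L → L, Set.InjOn g {z | z ≠ 0 ∧ z ∈ W} ∧
      ∀ z, z ≠ 0 → z ∈ W → g z ≠ 0 ∧ g z ∈ W ∧ (Good σ i d (g z) ↔ ¬Good σ i d z) := by
  obtain ⟨r, s, hrs⟩ := exists_sq_add_mul_sq hK hc
  choose! A B hAB using hspan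
  have hval : ∀ a b a' b' : K, rform σ i d (a • x + b • y) (a' • x + b' • y) =
      algebraMap K L (ρ * (a * a' + c * (b * b'))) := fun a b a' b' => by
    rw [rform_comb, hxx, hxy, hyy, mul_zero, add_zero, ← map_mul, ← map_mul, ← map_add]
    congr 1; ring
  have hzero : ∀ a b : K, a • x + b • y = 0 → a = 0 ∧ b = 0 :=
    LinearIndependent.pair_iff.1 hli
  have hne : ∀ z, z ≠ 0 → z ∈ W →
      (r * A z + c * s * B z) • x + (s * A z - r * B z) • y ≠ 0 := by
    intro z hz hzW h0
    obtain ⟨h1, h2⟩ := hzero _ _ h0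
    have hA : A z = 0 := by
      linear_combination (-r) * h1 - c * s * h2 + A z * hrs
    have hB : B z = 0 := by
      linear_combination (-s) * h1 + r * h2 + B z * hrs
    apply hz
    rw [hAB z hzW, hA, hB]; simp
  refine ⟨fun z => (r * A z + c * s * B z) • x + (s * A z - r * B z) • y, ?_, ?_⟩
  · rintro z ⟨-, hz⟩ w ⟨-, hw⟩ hzw
    dsimp only at hzw
    obtain ⟨h1, h2⟩ := hzero (r * A z + c * s * B z - (r * A w + c * s * B w))
      (s * A z - r * B z - (s * A w - r * B w)) (by
        rw [sub_smul, sub_smul]; linear_combination hzw)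
    have hA : A z = A w := by
      linear_combination (-r) * h1 - c * s * h2 + (A z - A w) * hrs
    have hB : B z = B w := by
      linear_combination (-s) * h1 + r * h2 + (B z - B w) * hrs
    rw [hAB z hz, hAB w hw, hA, hB]
  · intro z hz hzW
    refine ⟨hne z hz hzW, W.add_mem (W.smul_mem _ hx) (W.smul_mem _ hy), ?_⟩
    have hgg := hval (r * A z + c * s * B z) (s * A z - r * B z) (r * A z + c * s * B z)
      (s * A z - r * B z)
    have hzg := hval (A z) (B z) (r * A z + c * s * B z) (s * A z - r * B z)
    have hzz := hval (A z) (B z) (A z) (B z)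
    have hneg : ρ * ((r * A z + c * s * B z) * (r * A z + c * s * B z) +
        c * ((s * A z - r * B z) * (s * A z - r * B z))) =
        -(ρ * (A z * A z + c * (B z * B z))) := by
      linear_combination ρ * (A z * A z + c * (B z * B z)) * hrs
    rw [← hAB z hzW] at hzz hzg
    rw [hneg] at hgg
    by_cases h0 : ρ * (A z * A z + c * (B z * B z)) = 0
    · rw [h0, map_zero, h.rform_eq_zero_iff] at hzz
      rw [h0, neg_zero, map_zero, h.rform_eq_zero_iff] at hgg
      refine h.good_iff_of_rform hz (hne z hz hzW) hzz hgg (mul_ne_zero hρ ?_) hzg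
      have h0' : A z * A z + c * (B z * B z) = 0 := (mul_eq_zero.1 h0).resolve_left hρ
      intro h1
      have h2 : (2 : K) ≠ 0 := fun h2 => h.two_ne_zero (by
        rw [← map_ofNat (algebraMap K L), h2, map_zero])
      have hB : B z ≠ 0 := by
        intro hB
        have hA : A z = 0 := by simpa [hB] using h0'
        apply hz
        rw [hAB z hzW, hA, hB]; simp
      have h3 : s * A z = r * B z := by
        apply mul_left_cancel₀ (mul_ne_zero (mul_ne_zero h2 hc) hB)
        linear_combination h1 - r * h0'
      have h4 : B z * B z = 0 := by
        linear_combination (-s * s) * h0' + (s * A z + r * B z) * h3 + (B z * B z) * hrs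
      exact hB (mul_self_eq_zero.1 h4)
    · exact h.good_iff_of_rform_neg h0 hzz hgg

/-- On a totally singular line the good vectors are exchanged with the other ones by an injective
map. -/
lemma Frame.exists_flip_plane [Fintype K] [Fintype L] {σ : L →ₐ[K] L} {i d : L}
    (h : Frame σ i d) (hK : Fintype.card K % 2 = 1) {W : Submodule K L} (hW : finrank K W = 2)
    (hs : ∀ z ∈ W, Sing σ i d z) :
    ∃ g : L → L, Set.InjOn g {z | z ≠ 0 ∧ z ∈ W} ∧
      ∀ z, z ≠ 0 → z ∈ W → g z ≠ 0 ∧ g z ∈ W ∧ (Good σ i d (g z) ↔ ¬Good σ i d z) := by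
  by_cases hall : ∀ z ∈ W, tform σ z z = 0
  · obtain ⟨x, hxW, hx⟩ : ∃ x ∈ W, x ≠ 0 := by
      apply W.ne_bot_iff.1
      rintro rfl
      simp at hW
    obtain ⟨y, hyW, hli, hspan⟩ := exists_basis_of_finrank_two hW hx hxW
    have hxy : tform σ x y = 0 := by
      have hcomb := rform_comb σ i d x y 1 1 1 1
      simp only [one_smul, mul_one, map_one, one_mul, map_add] at hcomb
      rw [h.rform_eq_zero_iff.2 (hall _ (W.add_mem hxW hyW)), h.rform_eq_zero_iff.2 (hall x hxW),
        h.rform_eq_zero_iff.2 (hall y hyW)] at hcomb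
      rw [← h.rform_eq_zero_iff (i := i) (d := d)]
      apply mul_left_cancel₀ h.two_ne_zero
      linear_combination -hcomb
    have hc := h.map_map_div_of_orthogonal hx (hall x hxW) (hall y hyW) hxy
    have hcσ : σ (y / x) ≠ y / x := by
      intro h0
      obtain ⟨k, hk⟩ := h.fixed _ h0
      refine (LinearIndependent.pair_iff' hx).1 hli k ?_
      rw [Algebra.smul_def, hk]; field_simp
    refine ⟨fun z => d * z, fun _ _ _ _ => mul_left_cancel₀ h.d_ne_zero, fun z hz hzW =>
      ⟨mul_ne_zero h.d_ne_zero hz, ?_, h.good_d_mul hz (hall z hzW)⟩⟩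
    obtain ⟨a, b, rfl⟩ := hspan z hzW
    obtain ⟨r, s, hrs⟩ := h.exists_eq_add_mul
      (e := d * (algebraMap K L a + algebraMap K L b * (y / x))) hc hcσ (by
        simp only [map_mul, map_add, AlgHom.commutes, hc, h.map_map_d])
    have : d * (a • x + b • y) = r • x + s • y := by
      simp only [Algebra.smul_def]
      field_simp at hrs
      linear_combination hrs
    simp only [this]
    exact W.add_mem (W.smul_mem _ hxW) (W.smul_mem _ hyW)
  · push Not at hall
    obtain ⟨x, hxW, hxx⟩ := hall
    have hx : x ≠ 0 := by
      rintro rfl; simp [tform] at hxx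
    obtain ⟨y, hyW, hli, hspan⟩ := exists_basis_of_finrank_two hW hx hxW
    obtain ⟨ρ, hρ⟩ := h.sing_iff.1 (hs x hxW)
    have hρ0 : ρ ≠ 0 := by
      rintro rfl
      rw [map_zero, h.rform_eq_zero_iff] at hρ
      exact hxx hρ
    obtain ⟨τ, hτ⟩ := h.mem_range_of_sing (hs x hxW) (hs y hyW) (hs _ (W.add_mem hxW hyW))
    have hzero := LinearIndependent.pair_iff.1 hli
    set t : K := -(τ / ρ) with ht
    have hy'W : t • x + (1 : K) • y ∈ W := W.add_mem (W.smul_mem _ hxW) (W.smul_mem _ hyW)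
    have hy' : t • x + (1 : K) • y ≠ 0 := fun h0 => one_ne_zero (hzero _ _ h0).2
    have horth : rform σ i d x (t • x + (1 : K) • y) = 0 := by
      have := rform_comb σ i d x y 1 0 t 1
      simp only [one_smul, zero_smul, add_zero, one_mul, zero_mul, map_zero, map_one] at this
      rw [one_smul, this, hρ, hτ, ← map_mul, ← map_add, ht, ← map_zero (algebraMap K L)]
      congr 1
      field_simp
      ring
    obtain ⟨μ, hμ⟩ := h.sing_iff.1 (hs _ hy'W)
    have hμ0 : μ ≠ 0 := by
      rintro rfl
      rw [map_zero, h.rform_eq_zero_iff] at hμ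
      rw [rform_comm, h.rform_eq_zero_iff] at horth
      exact h.not_isSquare_of_rform hρ0 hρ (h.isSquare_of_orthogonal hy' hμ horth)
    refine h.exists_flip_of_orthogonal hK (ρ := ρ) (c := μ / ρ) hxW hy'W ?_ ?_ hρ0
      (div_ne_zero hμ0 hρ0) hρ horth (by rw [hμ]; congr 1; field_simp)
    · rw [LinearIndependent.pair_iff]
      intro a b hab
      obtain ⟨h1, h2⟩ := hzero (a + b * t) b (by
        rw [← hab]; module)
      exact ⟨by simpa [h2] using h1, h2⟩
    · intro z hz
      obtain ⟨a, b, rfl⟩ := hspan z hz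
      exact ⟨a - b * t, b, by module⟩

section Counting

variable [Fintype K] [Fintype L]

/-- A set of nonzero vectors that is closed under scaling consists of `q - 1` vectors on each of
its points. -/
lemma ncard_points_mul {T : Set L} (h0 : ∀ x ∈ T, x ≠ 0)
    (hT : ∀ x ∈ T, ∀ a : K, a ≠ 0 → a • x ∈ T) :
    ((fun x => K ∙ x) '' T).ncard * (Fintype.card K - 1) = T.ncard := by
  rw [Set.ncard_eq_toFinset_card', Set.ncard_eq_toFinset_card', Set.toFinset_image,
    Finset.card_eq_sum_card_image (fun x => K ∙ x) T.toFinset,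
    Finset.sum_const_nat (m := Fintype.card K - 1)]
  intro P hP
  obtain ⟨x, hxT, rfl⟩ := Finset.mem_image.1 hP
  rw [Set.mem_toFinset] at hxT
  have hx := h0 x hxT
  have hfib : {y ∈ T.toFinset | K ∙ y = K ∙ x} =
      (Finset.univ.erase (0 : K)).image (fun a => a • x) := by
    ext y
    simp only [Finset.mem_filter, Set.mem_toFinset, Finset.mem_image, Finset.mem_erase,
      Finset.mem_univ, and_true]
    constructor
    · rintro ⟨hyT, hy⟩
      obtain ⟨a, rfl⟩ := Submodule.mem_span_singleton.1 (hy ▸ Submodule.mem_span_singleton_self y)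
      exact ⟨a, fun ha => h0 _ hyT (by rw [ha, zero_smul]), rfl⟩
    · rintro ⟨a, ha, rfl⟩
      exact ⟨hT x hxT a ha, Submodule.span_singleton_smul_eq (IsUnit.mk0 a ha) x⟩
  rw [hfib, Finset.card_image_of_injective _ (smul_left_injective K hx),
    Finset.card_erase_of_mem (Finset.mem_univ _), Finset.card_univ]

end Counting

lemma two_mul_ncard_of_flip {α : Type*} [Finite α] {S : Set α} {G : α → Prop} {g : α → α}
    (hinj : Set.InjOn g S) (hS : ∀ x ∈ S, g x ∈ S) (hg : ∀ x ∈ S, (G (g x) ↔ ¬G x)) :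
    2 * {x ∈ S | G x}.ncard = S.ncard := by
  have h1 : {x ∈ S | G x}.ncard ≤ {x ∈ S | ¬G x}.ncard :=
    Set.ncard_le_ncard_of_injOn g (fun x hx => ⟨hS x hx.1, fun hh => (hg x hx.1).1 hh hx.2⟩)
      (hinj.mono fun x hx => hx.1) (Set.toFinite _)
  have h2 : {x ∈ S | ¬G x}.ncard ≤ {x ∈ S | G x}.ncard :=
    Set.ncard_le_ncard_of_injOn g (fun x hx => ⟨hS x hx.1, (hg x hx.1).2 hx.2⟩)
      (hinj.mono fun x hx => hx.1) (Set.toFinite _)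
  have h3 : {x ∈ S | G x}.ncard + {x ∈ S | ¬G x}.ncard = S.ncard := by
    rw [← Set.ncard_union_eq (by
      rw [Set.disjoint_left]; exact fun x hx hx' => hx'.2 hx.2) (Set.toFinite _) (Set.toFinite _)]
    congr 1
    ext x
    simp only [Set.mem_union, Set.mem_sep_iff]
    tauto
  omega

section Count

lemma ncard_eq_zero_le {F : Type*} [Field F] [Finite F] {n : ℕ} {r : Polynomial F}
    (hr : r ∈ Polynomial.degreeLT F n) :
    {x : F | x ^ n + r.eval x = 0}.ncard ≤ n := by
  rw [Polynomial.mem_degreeLT] at hr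
  have hm := Polynomial.monic_X_pow_add hr
  have hdeg : (Polynomial.X ^ n + r).natDegree = n := by
    apply Polynomial.natDegree_eq_of_degree_eq_some
    rw [Polynomial.degree_add_eq_left_of_degree_lt (by rwa [Polynomial.degree_X_pow]),
      Polynomial.degree_X_pow]
  calc _ ≤ ((Polynomial.X ^ n + r).roots.toFinset : Set F).ncard := by
        apply Set.ncard_le_ncard _ (Set.toFinite _)
        intro x hx
        simpa [hm.ne_zero] using hx
    _ ≤ n := by
        rw [Set.ncard_coe_finset]
        exact (Multiset.toFinset_card_le _).trans ((Polynomial.card_roots' _).trans hdeg.le)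

variable [Fintype K] [Fintype L]

lemma ncard_trace_eq_zero (q : ℕ) (hK : Fintype.card K = q) (hL : Fintype.card L = q ^ 6) :
    {t : L | t ≠ 0 ∧ t + t ^ q + t ^ q ^ 2 = 0}.ncard = q ^ 2 - 1 := by
  have hq : 1 < q := hK ▸ Fintype.one_lt_card
  set σ : L →ₗ[K] L := (FiniteField.frobeniusAlgHom K L).toLinearMap with hσ
  have hσx : ∀ x, σ x = x ^ q := fun x => by rw [← hK]; rfl
  set τ : L →ₗ[K] L := LinearMap.id + σ + σ ∘ₗ σ with hτ
  have hτx : ∀ x, τ x = x + x ^ q + x ^ q ^ 2 := fun x => by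
    simp only [hτ, LinearMap.add_apply, LinearMap.id_apply, LinearMap.comp_apply, hσx]
    ring
  have hker : (LinearMap.ker τ : Set L).ncard ≤ q ^ 2 := by
    refine le_trans (Set.ncard_le_ncard (fun x hx => ?_) (Set.toFinite _))
      (ncard_eq_zero_le (F := L) (n := q ^ 2) (r := Polynomial.X + Polynomial.X ^ q) ?_)
    · have hx' : τ x = 0 := hx
      rw [hτx] at hx'
      simp only [Set.mem_ofPred_eq, Polynomial.eval_add, Polynomial.eval_X, Polynomial.eval_pow]
      linear_combination hx'
    · refine add_mem ?_ ?_
      · rw [Polynomial.mem_degreeLT, Polynomial.degree_X]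
        exact_mod_cast Nat.one_lt_pow (by norm_num) hq
      · rw [Polynomial.mem_degreeLT, Polynomial.degree_X_pow]
        exact_mod_cast (by nlinarith : q < q ^ 2)
  have hrange : (LinearMap.range τ : Set L).ncard ≤ q ^ 4 := by
    refine le_trans (Set.ncard_le_ncard (fun x hx => ?_) (Set.toFinite _))
      (ncard_eq_zero_le (F := L) (n := q ^ 4)
        (r := Polynomial.X ^ q - Polynomial.X - Polynomial.X ^ q ^ 3) ?_)
    · obtain ⟨y, rfl⟩ := hx
      simp only [Set.mem_ofPred_eq, Polynomial.eval_sub, Polynomial.eval_X, Polynomial.eval_pow]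
      have h4 : ∀ z, z ^ q ^ 4 = σ (σ (σ (σ z))) := fun z => by simp only [hσx]; ring
      have h3 : ∀ z, z ^ q ^ 3 = σ (σ (σ z)) := fun z => by simp only [hσx]; ring
      have h6 : σ (σ (σ (σ (σ (σ y))))) = y := by
        have := FiniteField.pow_card y
        rw [hL] at this
        nth_rewrite 2 [← this]
        simp only [hσx]; ring
      rw [h4, h3, ← hσx]
      simp only [hτ, LinearMap.add_apply, LinearMap.id_apply, LinearMap.comp_apply, map_add, h6]
      ring
    · refine sub_mem (sub_mem ?_ ?_) ?_
      · rw [Polynomial.mem_degreeLT, Polynomial.degree_X_pow]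
        exact_mod_cast (by simpa using Nat.pow_lt_pow_right hq (show 1 < 4 by norm_num))
      · rw [Polynomial.mem_degreeLT, Polynomial.degree_X]
        exact_mod_cast Nat.one_lt_pow (by norm_num) hq
      · rw [Polynomial.mem_degreeLT, Polynomial.degree_X_pow]
        exact_mod_cast Nat.pow_lt_pow_right hq (show 3 < 4 by norm_num)
  have hmul : (LinearMap.ker τ : Set L).ncard * (LinearMap.range τ : Set L).ncard = q ^ 6 := by
    rw [← Nat.card_coe_set_eq, ← Nat.card_coe_set_eq]
    have h1 := Module.natCard_eq_pow_finrank (K := K) (V := LinearMap.ker τ)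
    have h2 := Module.natCard_eq_pow_finrank (K := K) (V := LinearMap.range τ)
    have h3 := Module.natCard_eq_pow_finrank (K := K) (V := L)
    have h4 := LinearMap.finrank_range_add_finrank_ker τ
    rw [Nat.card_eq_fintype_card, hL, ← h4, pow_add, mul_comm, ← h1, ← h2] at h3
    exact h3.symm
  have hcard : (LinearMap.ker τ : Set L).ncard = q ^ 2 := by
    refine le_antisymm hker ?_
    have : q ^ 2 * q ^ 4 ≤ (LinearMap.ker τ : Set L).ncard * q ^ 4 := by
      calc q ^ 2 * q ^ 4 = q ^ 6 := by ring
        _ ≤ _ := hmul ▸ Nat.mul_le_mul_left _ hrange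
    exact Nat.le_of_mul_le_mul_right this (by positivity)
  have hset : {t : L | t ≠ 0 ∧ t + t ^ q + t ^ q ^ 2 = 0} = (LinearMap.ker τ : Set L) \ {0} := by
    ext t
    simp [hτx, and_comm]
  rw [hset, Set.ncard_sdiff_singleton_of_mem (by simp), hcard]

lemma ncard_pow_eq {F : Type*} [Field F] [Fintype F] {m n : ℕ} (hm : 0 < m) (hn : 0 < n)
    (hF : Fintype.card F - 1 = m * n) {t : F} (ht : t ^ m = 1) :
    {x : F | x ^ n = t}.ncard = n := by
  obtain ⟨g, hg⟩ := IsCyclic.exists_generator (α := Fˣ)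
  have hord : orderOf g = m * n := by
    rw [orderOf_eq_card_of_forall_mem_zpowers hg, Nat.card_eq_fintype_card, Fintype.card_units, hF]
  have hζ : IsPrimitiveRoot ((g : F) ^ m) n := by
    have h1 : IsPrimitiveRoot (g : F) (m * n) := by
      rw [IsPrimitiveRoot.coe_units_iff, ← hord]; exact IsPrimitiveRoot.orderOf g
    exact h1.pow (by positivity) rfl
  have ht0 : t ≠ 0 := by
    rintro rfl; simp [hm.ne'] at ht
  have hex : ∃ α, α ^ n = t := by
    obtain ⟨k, hk⟩ := (mem_powers_iff_mem_zpowers.2 (hg (Units.mk0 t ht0)))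
    have hk1 : g ^ (k * m) = 1 := by
      rw [pow_mul]
      dsimp only at hk
      rw [hk]
      ext
      simpa using ht
    have hdvd := orderOf_dvd_of_pow_eq_one hk1
    rw [hord, mul_comm m n] at hdvd
    obtain ⟨l, rfl⟩ := Nat.dvd_of_mul_dvd_mul_right hm hdvd
    refine ⟨(g : F) ^ l, ?_⟩
    have := congrArg Units.val hk
    simpa [pow_mul, pow_right_comm] using this
  have hcard := hζ.card_nthRoots t
  rw [if_pos hex] at hcard
  rw [← Multiset.toFinset_card_of_nodup (hζ.nthRoots_nodup ht0), ← Set.ncard_coe_finset] at hcard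
  refine Eq.trans (congrArg Set.ncard ?_) hcard
  ext x
  simp [Polynomial.mem_nthRoots hn]

lemma ncard_singular (q : ℕ) (hK : Fintype.card K = q) (hL : Fintype.card L = q ^ 6) :
    {x : L | x ≠ 0 ∧ x ^ (q ^ 3 + 1) + x ^ ((q ^ 3 + 1) * q) + x ^ ((q ^ 3 + 1) * q ^ 2) = 0}.ncard
      = (q ^ 2 - 1) * (q ^ 3 + 1) := by
  have hq : 1 < q := hK ▸ Fintype.one_lt_card
  have hq3 : 1 < q ^ 3 := Nat.one_lt_pow (by norm_num) hq
  rw [← ncard_trace_eq_zero q hK hL, Set.ncard_eq_toFinset_card', Set.ncard_eq_toFinset_card',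
    Finset.card_eq_sum_card_fiberwise (f := fun x => x ^ (q ^ 3 + 1))
      (t := {t : L | t ≠ 0 ∧ t + t ^ q + t ^ q ^ 2 = 0}.toFinset) (by
        intro x hx
        simp only [Set.coe_toFinset, Set.mem_ofPred_eq] at hx ⊢
        exact ⟨pow_ne_zero _ hx.1, by rw [← pow_mul, ← pow_mul]; exact hx.2⟩)]
  apply Finset.sum_const_nat
  intro t ht
  simp only [Set.mem_toFinset, Set.mem_ofPred_eq] at ht
  obtain ⟨ht0, ht⟩ := ht
  have hpow : t ^ (q ^ 3 - 1) = 1 := by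
    have h1 : t ^ q ^ 3 = t := by
      have hfrob : ∀ z w : L, (z + w) ^ q = z ^ q + w ^ q := fun z w => by
        have := map_add (FiniteField.frobeniusAlgHom K L) z w
        simpa [FiniteField.coe_frobeniusAlgHom, hK] using this
      have h2 : (t + t ^ q + t ^ q ^ 2) ^ q = 0 := by rw [ht, zero_pow (by omega)]
      rw [hfrob, hfrob, ← pow_mul, ← pow_mul, ← pow_two, ← pow_succ] at h2
      linear_combination h2 - ht
    apply mul_right_cancel₀ ht0
    rw [← pow_succ, Nat.sub_add_cancel hq3.le, h1, one_mul]
  have hfib := ncard_pow_eq (m := q ^ 3 - 1) (n := q ^ 3 + 1) (by omega) (by omega) (by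
    rw [hL, show q ^ 6 = (q ^ 3) ^ 2 by ring]
    zify [hq3.le, Nat.one_le_pow 2 (q ^ 3) (by omega)]; ring) hpow
  rw [Set.ncard_eq_toFinset_card'] at hfib
  refine Eq.trans (congrArg Finset.card ?_) hfib
  ext x
  simp only [Finset.mem_filter, Set.mem_toFinset, Set.mem_ofPred_eq, and_iff_right_iff_imp]
  rintro rfl
  exact ⟨fun h0 => ht0 (by simp [h0]), by rw [pow_mul, pow_mul]; exact ht⟩

end Count

/-- The change of coordinates turning the norm form into the trace form. -/
def coordChange (σ : L →ₐ[K] L) (d : L) : L →ₗ[K] L where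
  toFun x := x + d * σ (σ (σ x))
  map_add' x y := by simp only [map_add]; ring
  map_smul' a x := by simp only [Algebra.smul_def, map_mul, AlgHom.commutes, RingHom.id_apply]; ring

namespace Frame

variable {σ : L →ₐ[K] L} {i d : L} (h : Frame σ i d)
include h

lemma coordChange_injective : Function.Injective (coordChange σ d) := by
  rw [injective_iff_map_eq_zero]
  intro x hx
  have hx : x + d * σ (σ (σ x)) = 0 := hx
  have h1 := congrArg (fun z => σ (σ (σ z))) hx
  simp only [map_add, map_mul, h.six, h.map_map_d, map_zero] at h1
  apply mul_left_cancel₀ h.two_ne_zero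
  linear_combination hx - d * h1 + x * h.d_mul

lemma coordChange_singular_iff {x N : L}
    (hx : coordChange σ d x * σ (σ (σ (coordChange σ d x))) = N) :
    N + σ N + σ (σ N) = 0 ↔ Sing σ i d x := by
  have hN : N = σ d * (x * x) + d * (σ (σ (σ x)) * σ (σ (σ x))) := by
    rw [← hx]
    simp only [coordChange, LinearMap.coe_mk, AddHom.coe_mk, map_add, map_mul, h.six, h.map_map_d]
    linear_combination x * σ (σ (σ x)) * h.d_mul
  rw [hN, Sing, rform, tform]
  simp only [map_add, map_mul, h.map_map_d, h.map_i]
  rw [← sub_eq_zero (b := i * _ * _), ← mul_right_inj' (neg_ne_zero.2 h.i_ne_zero)]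
  ring_nf

omit h in
lemma sing_smul {x : L} (hx : Sing σ i d x) (a : K) : Sing σ i d (a • x) := by
  have hcomb := rform_comb σ i d x x a 0 a 0
  simp only [zero_smul, add_zero, mul_zero, zero_mul, map_zero] at hcomb
  rw [Sing] at hx ⊢
  rw [hcomb, map_mul, AlgHom.commutes, hx]

end Frame

lemma exists_frame [Fintype K] [Fintype L] (q : ℕ) (hq4 : q % 4 = 3)
    (hK : Fintype.card K = q) (hL : Fintype.card L = q ^ 6) :
    ∃ i d : L, Frame (FiniteField.frobeniusAlgHom K L) i d := by
  set σ := FiniteField.frobeniusAlgHom K L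
  have hσ : ∀ x, σ x = x ^ q := fun x => by rw [← hK]; rfl
  have hneg : ¬IsSquare (-1 : K) := by
    rw [FiniteField.isSquare_neg_one_iff, hK, not_not, hq4]
  have hfix : ∀ x, σ x = x → ∃ k, algebraMap K L k = x := by
    intro x hx
    refine (IsGalois.mem_range_algebraMap_iff_fixed x).2 fun f => ?_
    obtain ⟨n, hn⟩ := (FiniteField.bijective_frobeniusAlgEquivOfAlgebraic_pow K L).2 f
    rw [← hn]
    dsimp only
    induction n.1 with
    | zero => rfl
    | succ m ih =>
      rw [pow_succ, AlgEquiv.mul_apply]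
      exact (congrArg _ hx).trans ih
  have hsix : ∀ x, σ (σ (σ (σ (σ (σ x))))) = x := fun x => by
    have := FiniteField.pow_card x
    rw [hL] at this
    nth_rewrite 2 [← this]
    simp only [hσ]; ring
  have hLsq : IsSquare (-1 : L) := by
    rw [FiniteField.isSquare_neg_one_iff, hL, Nat.pow_mod, hq4]; norm_num
  obtain ⟨i, hi⟩ := hLsq
  have hσi : σ i = -i := by
    have h1 : (σ i - i) * (σ i + i) = 0 := by
      have := congrArg σ hi
      simp only [map_mul, map_neg, map_one] at this
      linear_combination hi - this
    rcases mul_eq_zero.1 h1 with h2 | h2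
    · obtain ⟨k, rfl⟩ := hfix i (sub_eq_zero.1 h2)
      refine absurd ⟨k, (algebraMap K L).injective ?_⟩ hneg
      rw [map_mul, ← hi, map_neg, map_one]
    · exact eq_neg_of_add_eq_zero_left h2
  obtain ⟨r, s, hrs⟩ := exists_sq_add_mul_sq (F := K) (by omega) one_ne_zero
  have hrs' := congrArg (algebraMap K L) hrs
  simp only [map_add, map_mul, map_neg, map_one] at hrs'
  refine ⟨i, algebraMap K L r + algebraMap K L s * i, hfix, hsix, hi.symm, hσi, ?_, ?_, hneg⟩
  · simp only [map_add, map_mul, AlgHom.commutes, hσi, map_neg, neg_neg]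
  · simp only [map_add, map_mul, AlgHom.commutes, hσi]
    linear_combination hrs' + algebraMap K L s * algebraMap K L s * hi

end Hemisystem

/-- **Theorem 1.1 (dual formulation).** For every prime power `q ≡ 3 (mod 4)` there is a
`(q+1)/2`-ovoid of the elliptic quadric `Q⁻(5,q)`, modelled inside `F_{q^6}` with the
quadratic form `Q(x) = Tr_{q^3/q}(x^{q^3+1}) = x^{q^3+1} + (x^{q^3+1})^q + (x^{q^3+1})^{q^2}`. -/
theorem hemisystem_exists
    (q : ℕ) (hq : IsPrimePow q) (hq4 : q % 4 = 3)
    (K L : Type) [Field K] [Fintype K] [Field L] [Fintype L] [Algebra K L]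
    (hK : Fintype.card K = q) (hL : Fintype.card L = q ^ 6) :
    ∃ M : Set (Submodule K L),
      (∀ P ∈ M, Module.finrank K P = 1 ∧
        ∀ x ∈ P, x ^ (q ^ 3 + 1) + x ^ ((q ^ 3 + 1) * q) + x ^ ((q ^ 3 + 1) * q ^ 2) = 0) ∧
      M.ncard = (q + 1) * (q ^ 3 + 1) / 2 ∧
      (∀ W : Submodule K L, Module.finrank K W = 2 →
        (∀ x ∈ W, x ^ (q ^ 3 + 1) + x ^ ((q ^ 3 + 1) * q) + x ^ ((q ^ 3 + 1) * q ^ 2) = 0) →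
        {P ∈ M | P ≤ W}.ncard = (q + 1) / 2) := by
  have hK4 : Fintype.card K % 4 = 3 := hK ▸ hq4
  obtain ⟨i, d, hf⟩ := Hemisystem.exists_frame q hq4 hK hL
  set σ := FiniteField.frobeniusAlgHom K L
  have hσ : ∀ x, σ x = x ^ q := fun x => by rw [← hK]; rfl
  set φ := Hemisystem.coordChange σ d
  have hφ : Function.Injective φ := hf.coordChange_injective
  have hφs : Function.Surjective φ := Finite.injective_iff_surjective.1 hφ
  have hQ : ∀ x, φ x ^ (q ^ 3 + 1) + φ x ^ ((q ^ 3 + 1) * q) + φ x ^ ((q ^ 3 + 1) * q ^ 2) = 0 ↔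
      Hemisystem.Sing σ i d x := fun x => by
    rw [← hf.coordChange_singular_iff (x := x) rfl]
    simp only [hσ]
    ring_nf
    rfl
  have hq3 : 3 ≤ q := by omega
  have hsing : {x : L | x ≠ 0 ∧ Hemisystem.Sing σ i d x}.ncard = (q ^ 2 - 1) * (q ^ 3 + 1) := by
    rw [← Hemisystem.ncard_singular q hK hL, ← Set.ncard_image_of_injective _ hφ]
    congr 1
    ext y
    obtain ⟨x, rfl⟩ := hφs y
    simp only [Set.mem_image, Set.mem_ofPred_eq, hQ, hφ.eq_iff, exists_eq_right, ne_eq,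
      map_eq_zero_iff φ hφ]
  have hpoints : ∀ (S : Set L) (n : ℕ), (∀ x ∈ S, x ≠ 0) → (∀ x ∈ S, ∀ a : K, a ≠ 0 → a • x ∈ S) →
      S.ncard = (q ^ 2 - 1) * n →
      (∃ g : L → L, Set.InjOn g S ∧ ∀ x ∈ S, g x ∈ S ∧
        (Hemisystem.Good σ i d (g x) ↔ ¬Hemisystem.Good σ i d x)) →
      ((fun y => K ∙ y) '' (φ '' {x ∈ S | Hemisystem.Good σ i d x})).ncard = (q + 1) * n / 2 := by
    rintro S n hS0 hS hSn ⟨g, hg, hgS⟩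
    have h1 := Hemisystem.two_mul_ncard_of_flip hg (fun x hx => (hgS x hx).1)
      (fun x hx => (hgS x hx).2)
    have h2 := Hemisystem.ncard_points_mul (K := K) (T := φ '' {x ∈ S | Hemisystem.Good σ i d x})
      (by
        rintro _ ⟨x, ⟨hx, -⟩, rfl⟩
        exact (map_ne_zero_iff φ hφ).2 (hS0 x hx))
      (by
        rintro _ ⟨x, ⟨hx, hx'⟩, rfl⟩ a ha
        exact ⟨a • x, ⟨hS x hx a ha, hf.good_smul hx' ha⟩, map_smul φ a x⟩)
    rw [Set.ncard_image_of_injective _ hφ, hK] at h2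
    rw [← h2, hSn, show q ^ 2 - 1 = (q - 1) * (q + 1) by
      rw [mul_comm, ← Nat.sq_sub_sq, one_pow]] at h1
    symm
    apply Nat.div_eq_of_eq_mul_right two_pos
    apply Nat.eq_of_mul_eq_mul_left (show 0 < q - 1 by omega)
    linarith
  refine ⟨(fun y => K ∙ y) '' (φ '' {x ∈ {x | x ≠ 0 ∧ Hemisystem.Sing σ i d x} |
    Hemisystem.Good σ i d x}), ?_, ?_, ?_⟩
  · rintro _ ⟨_, ⟨x, ⟨⟨hx0, hx⟩, -⟩, rfl⟩, rfl⟩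
    refine ⟨finrank_span_singleton ((map_ne_zero_iff φ hφ).2 hx0), fun y hy => ?_⟩
    obtain ⟨a, rfl⟩ := Submodule.mem_span_singleton.1 hy
    rw [← map_smul, hQ]
    exact Hemisystem.Frame.sing_smul hx a
  · refine hpoints _ _ (fun x hx => hx.1) (fun x hx a ha => ⟨smul_ne_zero ha hx.1,
      Hemisystem.Frame.sing_smul hx.2 a⟩) hsing ?_
    obtain ⟨g, hg, hgS⟩ := hf.exists_flip_sing
    exact ⟨g, hg, fun x hx => ⟨⟨(hgS x hx.1 hx.2).1, (hgS x hx.1 hx.2).2.1⟩,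
      (hgS x hx.1 hx.2).2.2⟩⟩
  · intro W hW hWs
    set e : L ≃ₗ[K] L := LinearEquiv.ofBijective φ ⟨hφ, hφs⟩
    have hW' : Module.finrank K (W.comap φ) = 2 := by
      rw [← hW]
      exact (e.submoduleMap (W.comap φ)).finrank_eq.trans
        (congrArg (fun V : Submodule K L => Module.finrank K V)
          (Submodule.map_comap_eq_of_surjective hφs W))
    have hs : ∀ z ∈ W.comap φ, Hemisystem.Sing σ i d z := fun z hz => (hQ z).1 (hWs _ hz)
    have hcard : {z | z ≠ 0 ∧ z ∈ W.comap φ}.ncard = q ^ 2 - 1 := by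
      have h1 := Module.natCard_eq_pow_finrank (K := K) (V := W.comap φ)
      rw [hW', Nat.card_eq_fintype_card (α := K), hK] at h1
      rw [← h1]
      refine Eq.trans ?_ (Set.ncard_sdiff_singleton_of_mem (W.comap φ).zero_mem)
      congr 1
      ext z
      simp [and_comm]
    have hmain := hpoints {z | z ≠ 0 ∧ z ∈ W.comap φ} 1 (fun x hx => hx.1)
      (fun x hx a ha => ⟨smul_ne_zero ha hx.1, Submodule.smul_mem _ _ hx.2⟩) (by rw [hcard, mul_one])
      (by
        obtain ⟨g, hg, hgS⟩ := hf.exists_flip_plane (by omega) hW' hs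
        exact ⟨g, hg, fun x hx => ⟨⟨(hgS x hx.1 hx.2).1, (hgS x hx.1 hx.2).2.1⟩,
          (hgS x hx.1 hx.2).2.2⟩⟩)
    rw [mul_one] at hmain
    rw [← hmain]
    congr 1
    ext P
    constructor
    · rintro ⟨⟨_, ⟨x, ⟨⟨hx0, hx⟩, hxG⟩, rfl⟩, rfl⟩, hP⟩
      exact ⟨_, ⟨x, ⟨⟨hx0, (Submodule.span_singleton_le_iff_mem (φ x) W).1 hP⟩, hxG⟩, rfl⟩, rfl⟩
    · rintro ⟨_, ⟨x, ⟨⟨hx0, hx⟩, hxG⟩, rfl⟩, rfl⟩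
      exact ⟨⟨_, ⟨x, ⟨⟨hx0, hs x hx⟩, hxG⟩, rfl⟩, rfl⟩,
        (Submodule.span_singleton_le_iff_mem _ _).2 hx⟩
end

section
/- For every prime power q with q ≡ 3 (mod 4) and every generator γ of the multiplicative group of F_{q^6}, there exists a set M of one-dimensional F_q-subspaces of F_{q^6}, each contained in the zero set of Q, with |M| = (q+1)(q^3+1)/2, such that: (i) every two-dimensional F_q-subspace of F_{q^6} on which Q vanishes identically contains exactly (q+1)/2 members of M; (ii) if the span of v belongs to M then the span of γ^{4(q^2+q+1)}·v belongs to M; and (iii) if the span of v belongs to M then the span of v^{q^2} belongs to M. (The maps in (ii) and (iii) induce a metacyclic group C_{(q^3+1)/4} : C_3 of collineations stabilizing the hemisystem.) -/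
open scoped Classical

section QuadraticCharacter

variable {F : Type*} [Field F] [Fintype F]

theorem FiniteField.ringChar_ne_two_of_card_mod_four (hF : Fintype.card F % 4 = 3) :
    ringChar F ≠ 2 := by
  intro h
  have := FiniteField.even_card_iff_char_two.1 h
  omega

theorem FiniteField.two_ne_zero_of_card_mod_four (hF : Fintype.card F % 4 = 3) :
    (2 : F) ≠ 0 :=
  Ring.two_ne_zero (FiniteField.ringChar_ne_two_of_card_mod_four hF)

theorem quadraticChar_neg_of_card_mod_four (hF : Fintype.card F % 4 = 3) (a : F) :
    quadraticChar F (-a) = -quadraticChar F a := by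
  rw [neg_eq_neg_one_mul, map_mul,
    quadraticChar_neg_one (FiniteField.ringChar_ne_two_of_card_mod_four hF),
    ZMod.χ₄_nat_three_mod_four hF, neg_one_mul]

theorem quadraticChar_inv_apply (a : F) : quadraticChar F a⁻¹ = quadraticChar F a := by
  by_cases ha : a = 0
  · simp [ha]
  · have h : quadraticChar F a * quadraticChar F a⁻¹ = 1 := by
      rw [← map_mul, mul_inv_cancel₀ ha, map_one]
    rcases quadraticChar_dichotomy ha with h1 | h1 <;> rw [h1] at h ⊢ <;> linarith

theorem quadraticChar_mul_self_of_ne_zero {a : F} (ha : a ≠ 0) :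
    quadraticChar F a * quadraticChar F a = 1 := by
  rw [← sq, quadraticChar_sq_one ha]

/-- Substituting a square in a sum weights each term by its number of square roots. -/
theorem sum_comp_sq (hF : ringChar F ≠ 2) (g : F → ℤ) :
    ∑ z : F, g (z ^ 2) = ∑ x : F, (1 + quadraticChar F x) * g x := by
  rw [← Finset.sum_fiberwise Finset.univ (fun z : F => z ^ 2) (fun z => g (z ^ 2))]
  refine Finset.sum_congr rfl fun x _ => ?_
  rw [Finset.sum_congr rfl (g := fun _ => g x)
    (fun z hz => by rw [(Finset.mem_filter.mp hz).2]), Finset.sum_const, nsmul_eq_mul]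
  congr 1
  have := quadraticChar_card_sqrts hF x
  rw [add_comm, ← this]
  congr 2
  ext z
  simp

/-- The sum of a function that is odd under a bijection vanishes. -/
theorem sum_eq_zero_of_odd {α : Type*} [Fintype α] (e : α ≃ α) (g : α → ℤ)
    (h : ∀ a, g (e a) = -g a) : ∑ a, g a = 0 := by
  have h1 : ∑ a, g (e a) = ∑ a, g a := e.sum_comp g
  rw [Finset.sum_congr rfl (fun a _ => h a), Finset.sum_neg_distrib] at h1
  linarith

end QuadraticCharacter

section Extension

variable {K E : Type*} [Field K] [Fintype K] [Field E] [Fintype E] [Algebra K E]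

theorem quadraticChar_algebraMap_of_odd_finrank
    (hd : Odd (Module.finrank K E)) (k : K) :
    quadraticChar E (algebraMap K E k) = quadraticChar K k := by
  by_cases hk : k = 0
  · simp [hk]
  have hs : IsSquare (algebraMap K E k) ↔ IsSquare k := by
    constructor
    · rintro ⟨z, hz⟩
      have h := congrArg (Algebra.norm K) hz
      rw [Algebra.norm_algebraMap, map_mul] at h
      obtain ⟨m, hm⟩ := hd
      rw [hm] at h
      refine ⟨Algebra.norm K z / k ^ m, ?_⟩
      field_simp
      linear_combination h
    · rintro ⟨z, rfl⟩
      exact ⟨algebraMap K E z, by simp⟩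
  by_cases h : IsSquare k
  · rw [(quadraticChar_one_iff_isSquare hk).2 h,
      (quadraticChar_one_iff_isSquare (by simpa using hk)).2 (hs.2 h)]
  · rw [quadraticChar_neg_one_iff_not_isSquare.2 h,
      quadraticChar_neg_one_iff_not_isSquare.2 (fun h' => h (hs.1 h'))]

end Extension

section LinearFunctional

variable {K V : Type*} [Field K] [Fintype K] [AddCommGroup V] [Module K V] [Fintype V]

theorem card_fiber_mul_card (g : V →ₗ[K] K) (hg : g ≠ 0) (k : K) :
    (Finset.univ.filter fun v => g v = k).card * Fintype.card K = Fintype.card V := by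
  have hs : Function.Surjective g := LinearMap.surjective_of_ne_zero hg
  have h : ∀ b, (Finset.univ.filter fun v => g v = b).card =
      (Finset.univ.filter fun v => g v = k).card := fun b =>
    AddMonoidHom.card_fiber_eq_of_mem_range g.toAddMonoidHom (hs b) (hs k)
  have h1 := Finset.card_eq_sum_card_fiberwise (s := Finset.univ) (t := Finset.univ) (f := g)
    (fun _ _ => Finset.mem_coe.2 (Finset.mem_univ _))
  rw [Finset.sum_congr rfl (fun b _ => h b), Finset.sum_const, smul_eq_mul, Finset.card_univ,
    Finset.card_univ] at h1
  rw [h1, mul_comm]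

end LinearFunctional

section ConeSign

variable {K E : Type*} [Field K] [Fintype K] [Field E] [Fintype E] [Algebra K E]

theorem exists_trace_mul_ne_zero {c : E} (hc : c ≠ 0) : ∃ y, Algebra.trace K E (c * y) ≠ 0 := by
  by_contra! h
  exact hc ((traceForm_nondegenerate K E).1 c h)

theorem exists_isotropic {K E : Type*} [Field K] [Field E] [Fintype E] [Algebra K E]
    (hE : Fintype.card E % 4 = 3) (hd : 2 ≤ Module.finrank K E) :
    ∃ d : E, d ≠ 0 ∧ Algebra.trace K E (d * d) = 0 := by
  have hker : LinearMap.ker (Algebra.trace K E) ≠ ⊥ :=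
    LinearMap.ker_ne_bot_of_finrank_lt (by rw [Module.finrank_self]; omega)
  obtain ⟨w, hw, hw0⟩ := Submodule.exists_mem_ne_zero_of_ne_bot hker
  rw [LinearMap.mem_ker] at hw
  by_cases h : IsSquare w
  · obtain ⟨d, rfl⟩ := h
    exact ⟨d, by rintro rfl; simp at hw0, hw⟩
  · have h1 : IsSquare (-w) := by
      rw [← quadraticChar_one_iff_isSquare (by simpa using hw0),
        quadraticChar_neg_of_card_mod_four hE, quadraticChar_neg_one_iff_not_isSquare.2 h, neg_neg]
    obtain ⟨d, hd⟩ := h1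
    exact ⟨d, by rintro rfl; simp [hw0] at hd, by rw [← hd, map_neg, hw, neg_zero]⟩

/-- The trace form of a cubic extension is the orthogonal sum of a hyperbolic plane and a line. -/
theorem exists_hyperbolic_basis (hK : Fintype.card K % 4 = 3) (hE : Fintype.card E % 4 = 3)
    (hd : Module.finrank K E = 3) :
    ∃ (φ : (K × K × K) ≃ E) (ρ : K), ρ ≠ 0 ∧ (∀ (k : K) (x : K × K × K), φ (k • x) = k • φ x) ∧
      ∀ x y : K × K × K, Algebra.trace K E (φ x * φ y) =
        x.1 * y.2.1 + x.2.1 * y.1 + ρ * (x.2.2 * y.2.2) := by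
  have h2 := FiniteField.two_ne_zero_of_card_mod_four hK
  obtain ⟨d, hd0, hdd⟩ := exists_isotropic (K := K) hE (by omega)
  obtain ⟨y, hy⟩ := exists_trace_mul_ne_zero (K := K) hd0
  obtain ⟨z, hz⟩ : ∃ z, Algebra.trace K E (d * z) = 1 :=
    ⟨(Algebra.trace K E (d * y))⁻¹ • y, by
      rw [mul_smul_comm, map_smul, smul_eq_mul, inv_mul_cancel₀ hy]⟩
  obtain ⟨e, hde, hee⟩ : ∃ e, Algebra.trace K E (d * e) = 1 ∧ Algebra.trace K E (e * e) = 0 := by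
    refine ⟨z - (Algebra.trace K E (z * z) / 2) • d, ?_, ?_⟩
    · rw [mul_sub, mul_smul_comm, map_sub, map_smul, hdd, hz]
      simp
    · have : (z - (Algebra.trace K E (z * z) / 2) • d) * (z - (Algebra.trace K E (z * z) / 2) • d)
          = z * z - (2 * (Algebra.trace K E (z * z) / 2)) • (d * z)
            + (Algebra.trace K E (z * z) / 2) ^ 2 • (d * d) := by
        simp only [Algebra.smul_def, map_mul, map_pow, map_ofNat]
        ring
      rw [this, map_add, map_sub, map_smul, map_smul, hdd, hz, mul_div_cancel₀ _ h2]
      simp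
  let g : E →ₗ[K] K × K :=
    ((Algebra.traceForm K E) d).prod ((Algebra.traceForm K E) e)
  have hker : LinearMap.ker g ≠ ⊥ :=
    LinearMap.ker_ne_bot_of_finrank_lt (by rw [Module.finrank_prod, Module.finrank_self]; omega)
  obtain ⟨m, hm, hm0⟩ := Submodule.exists_mem_ne_zero_of_ne_bot hker
  have hm' : Algebra.trace K E (d * m) = 0 ∧ Algebra.trace K E (e * m) = 0 := by
    simpa [g, LinearMap.mem_ker, Algebra.traceForm_apply] using hm
  obtain ⟨hdm, hem⟩ := hm'
  let ψ : K × K × K → E := fun x => x.1 • d + x.2.1 • e + x.2.2 • m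
  have hψ : ∀ x y, Algebra.trace K E (ψ x * ψ y) =
      x.1 * y.2.1 + x.2.1 * y.1 + Algebra.trace K E (m * m) * (x.2.2 * y.2.2) := by
    intro x y
    have : ψ x * ψ y = (x.1 * y.1) • (d * d) + (x.2.1 * y.2.1) • (e * e)
        + (x.2.2 * y.2.2) • (m * m) + (x.1 * y.2.1 + x.2.1 * y.1) • (d * e)
        + (x.1 * y.2.2 + x.2.2 * y.1) • (d * m) + (x.2.1 * y.2.2 + x.2.2 * y.2.1) • (e * m) := by
      simp only [ψ, Algebra.smul_def, map_mul, map_add]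
      ring
    rw [this]
    simp only [map_add, map_smul, hdd, hee, hde, hdm, hem, smul_eq_mul]
    ring
  have hsub : ∀ x y, ψ x - ψ y = ψ (x - y) := by
    intro x y
    simp only [ψ, Prod.fst_sub, Prod.snd_sub, sub_smul]
    abel
  have hinj : Function.Injective ψ := by
    intro x y hxy
    rw [← sub_eq_zero, hsub] at hxy
    rw [← sub_eq_zero]
    generalize x - y = u at hxy
    have h1 := hψ u (1, 0, 0)
    have h3 := hψ u (0, 1, 0)
    rw [hxy] at h1 h3
    simp at h1 h3
    have h4 : u.2.2 = 0 := by
      simp only [ψ, ← h1, ← h3, zero_smul, zero_add] at hxy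
      exact (smul_eq_zero.1 hxy).resolve_right hm0
    ext <;> simp [h1.symm, h3.symm, h4]
  have hcard : Fintype.card (K × K × K) = Fintype.card E := by
    rw [Module.card_eq_pow_finrank (K := K) (V := E), hd, Fintype.card_prod, Fintype.card_prod]
    ring
  have hbij := (Fintype.bijective_iff_injective_and_card ψ).2 ⟨hinj, hcard⟩
  refine ⟨Equiv.ofBijective ψ hbij, Algebra.trace K E (m * m), ?_, ?_, hψ⟩
  · intro h0
    obtain ⟨y, hy⟩ := exists_trace_mul_ne_zero (K := K) hm0
    obtain ⟨x, rfl⟩ := hbij.2 y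
    have hmψ : m = ψ (0, 0, 1) := by simp [ψ]
    rw [hmψ, hψ, h0] at hy
    simp at hy
  · intro k x
    simp [ψ, smul_add, smul_smul]

/-- `sgn` picks one of two opposite halves of the nonzero vectors of the cone `Tr (c ^ 2) = 0`,
in such a way that the square class of `Tr (c * c')` on each half is constant. -/
structure IsConeSign (sgn : E → ℤ) (ε : ℤ) : Prop where
  eps_mul_self : ε * ε = 1
  ne_zero_iff : ∀ c, sgn c ≠ 0 ↔ c ≠ 0 ∧ Algebra.trace K E (c * c) = 0
  mul_self : ∀ c, sgn c ≠ 0 → sgn c * sgn c = 1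
  smul : ∀ (k : K) c, sgn (k • c) = quadraticChar K k * sgn c
  mul_eq : ∀ c c', sgn c ≠ 0 → sgn c' ≠ 0 → Algebra.trace K E (c * c') ≠ 0 →
    sgn c * sgn c' = ε * quadraticChar K (Algebra.trace K E (c * c'))
  exists_smul : ∀ c c', sgn c ≠ 0 → sgn c' ≠ 0 → Algebra.trace K E (c * c') = 0 →
    ∃ k : K, c' = k • c
  sum_trace_one : ∑ v : E, (if Algebra.trace K E v = 1 then quadraticChar E v else 0) =
    -(Fintype.card K * ε * quadraticChar K 2)

theorem card_hyperbolic_eq_one (hK : Fintype.card K % 4 = 3) {ρ : K} (hρ : ρ ≠ 0) :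
    ∑ x : K × K × K, (if x.1 * x.2.1 + x.2.1 * x.1 + ρ * (x.2.2 * x.2.2) = 1 then (1 : ℤ) else 0) =
      Fintype.card K ^ 2 + Fintype.card K * quadraticChar K ρ := by
  have h2 := FiniteField.two_ne_zero_of_card_mod_four hK
  have hchar := FiniteField.ringChar_ne_two_of_card_mod_four hK
  rw [Fintype.sum_prod_type_right, Fintype.sum_prod_type]
  have key : ∀ t : K, ∑ w : K, ∑ s : K,
      (if s * t + t * s + ρ * (w * w) = 1 then (1 : ℤ) else 0) =
      Fintype.card K + if t = 0 then Fintype.card K * quadraticChar K ρ else 0 := by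
    intro t
    by_cases ht : t = 0
    · subst ht
      have h := quadraticChar_card_sqrts hchar ρ⁻¹
      simp only [mul_zero, zero_mul, zero_add, Finset.sum_const, Finset.card_univ, nsmul_eq_mul,
        if_true]
      rw [← Finset.mul_sum, Finset.sum_boole, ← quadraticChar_inv_apply ρ]
      have h3 : (Finset.univ.filter fun w : K => ρ * (w * w) = 1) =
          {x : K | x ^ 2 = ρ⁻¹}.toFinset := by
        ext w
        simp only [Finset.mem_filter, Finset.mem_univ, true_and, Set.mem_toFinset,
          Set.mem_ofPred_eq]
        rw [← sq]
        constructor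
        · intro h
          field_simp
          linear_combination h
        · intro h
          rw [h, mul_inv_cancel₀ hρ]
      rw [h3, h]
      ring
    · have h3 : ∀ w : K, ∑ s : K, (if s * t + t * s + ρ * (w * w) = 1 then (1 : ℤ) else 0) = 1 := by
        intro w
        rw [Finset.sum_eq_single ((1 - ρ * (w * w)) / (2 * t))]
        · rw [if_pos]
          field_simp
          ring
        · intro s _ hs
          rw [if_neg]
          intro h
          apply hs
          field_simp
          linear_combination h
        · simp
      simp [h3, ht]
  simp only [key]
  rw [Finset.sum_add_distrib]
  simp
  ring

theorem exists_isConeSign (hK : Fintype.card K % 4 = 3) (hE : Fintype.card E % 4 = 3)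
    (hd : Module.finrank K E = 3) :
    ∃ (sgn : E → ℤ) (ε : ℤ), IsConeSign (K := K) sgn ε := by
  obtain ⟨φ, ρ, hρ, hφs, hφ⟩ := exists_hyperbolic_basis (E := E) hK hE hd
  have h2 := FiniteField.two_ne_zero_of_card_mod_four hK
  have hchar := FiniteField.ringChar_ne_two_of_card_mod_four hK
  have hφ0 : φ 0 = 0 := by simpa using hφs 0 0
  have hcone : ∀ x : K × K × K, Algebra.trace K E (φ x * φ x) = 2 * (x.1 * x.2.1) + ρ * x.2.2 ^ 2 := by
    intro x; rw [hφ]; ring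
  let ε : ℤ := quadraticChar K (-2 * ρ)
  have hε : ε * ε = 1 := quadraticChar_mul_self_of_ne_zero (by simp [h2, hρ])
  let σ : K × K × K → ℤ := fun x =>
    if 2 * (x.1 * x.2.1) + ρ * x.2.2 ^ 2 = 0 then
      (if x.2.1 = 0 then ε * quadraticChar K x.1 else quadraticChar K x.2.1) else 0
  have hσ : ∀ x, σ x ≠ 0 ↔ x ≠ 0 ∧ 2 * (x.1 * x.2.1) + ρ * x.2.2 ^ 2 = 0 := by
    rintro ⟨s, t, w⟩
    by_cases hc : 2 * (s * t) + ρ * w ^ 2 = 0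
    · by_cases ht : t = 0
      · subst ht
        have hw : w = 0 := by simpa [hρ] using hc
        have hε0 : ε ≠ 0 := by intro h; simp [h] at hε
        simp [-quadraticChar_apply, quadraticChar_eq_zero_iff, σ, hw, hε0]
      · simp [-quadraticChar_apply, quadraticChar_eq_zero_iff, σ, hc, ht]
    · simp [σ, hc]
  refine ⟨fun c => σ (φ.symm c), ε, hε, ?_, ?_, ?_, ?_, ?_, ?_⟩
  · intro c
    obtain ⟨x, rfl⟩ := φ.surjective c
    rw [φ.symm_apply_apply, hσ, hcone, Ne, Ne, ← hφ0, φ.apply_eq_iff_eq]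
  · intro c h
    generalize φ.symm c = x at *
    simp only [σ] at h ⊢
    split_ifs at h ⊢ with h1 h3
    · have h4 : x.1 ≠ 0 := by rintro h5; simp [h5] at h
      rw [mul_mul_mul_comm, hε, quadraticChar_mul_self_of_ne_zero h4, one_mul]
    · exact quadraticChar_mul_self_of_ne_zero h3
    · exact absurd rfl h
  · intro k c
    obtain ⟨x, rfl⟩ := φ.surjective c
    rw [← hφs, φ.symm_apply_apply, φ.symm_apply_apply]
    by_cases hk : k = 0
    · simp [hk, σ]
    · have h3 : 2 * (k * x.1 * (k * x.2.1)) + ρ * (k * x.2.2) ^ 2 =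
          k ^ 2 * (2 * (x.1 * x.2.1) + ρ * x.2.2 ^ 2) := by ring
      simp only [σ, Prod.smul_fst, Prod.smul_snd, smul_eq_mul, h3, mul_eq_zero, hk, map_mul,
        pow_eq_zero_iff two_ne_zero, false_or]
      split_ifs <;> ring
  · intro c c' hc hc' h
    obtain ⟨⟨s, t, w⟩, rfl⟩ := φ.surjective c
    obtain ⟨⟨s', t', w'⟩, rfl⟩ := φ.surjective c'
    rw [φ.symm_apply_apply] at hc hc' ⊢
    rw [φ.symm_apply_apply]
    have hc1 := ((hσ _).1 hc).2
    have hc1' := ((hσ _).1 hc').2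
    rw [hφ] at h ⊢
    dsimp only at hc1 hc1' h ⊢
    simp only [σ, hc1, hc1', if_true]
    by_cases ht : t = 0
    · subst ht
      have hw : w = 0 := by simpa [hρ] using hc1
      subst hw
      have ht' : t' ≠ 0 := by rintro rfl; simp at h
      simp [-quadraticChar_apply, ht', map_mul]
      ring
    by_cases ht' : t' = 0
    · subst ht'
      have hw : w' = 0 := by simpa [hρ] using hc1'
      subst hw
      simp [-quadraticChar_apply, ht, map_mul]
      ring
    simp only [ht, ht', if_false]
    have h3 : (2 * t * t') ^ 2 * (s * t' + t * s' + ρ * (w * w')) =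
        (-2 * ρ) * (t * t') * (w * t' - w' * t) ^ 2 := by
      linear_combination (2 * t * t' ^ 3) * hc1 + (2 * t' * t ^ 3) * hc1'
    have h4 : w * t' - w' * t ≠ 0 := by
      intro h5
      rw [h5] at h3
      simp [h2, ht, ht', h] at h3
    have h5 := congrArg (quadraticChar K) h3
    rw [map_mul, quadraticChar_sq_one' (by simp [h2, ht, ht']), one_mul, map_mul,
      quadraticChar_sq_one' h4, mul_one, map_mul, map_mul (quadraticChar K) t] at h5
    rw [h5]
    linear_combination (-(quadraticChar K t * quadraticChar K t')) * hε
  · intro c c' hc hc' h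
    obtain ⟨⟨s, t, w⟩, rfl⟩ := φ.surjective c
    obtain ⟨⟨s', t', w'⟩, rfl⟩ := φ.surjective c'
    rw [φ.symm_apply_apply] at hc hc'
    have hc1 := ((hσ _).1 hc).2
    have hc1' := ((hσ _).1 hc').2
    have hc0 := ((hσ _).1 hc).1
    rw [hφ] at h
    dsimp only at hc1 hc1' h
    simp_rw [← hφs, φ.apply_eq_iff_eq]
    by_cases ht : t = 0
    · subst ht
      have hw : w = 0 := by simpa [hρ] using hc1
      subst hw
      have hs : s ≠ 0 := by rintro rfl; simp at hc0
      have ht' : t' = 0 := by simpa [hs] using h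
      subst ht'
      have hw' : w' = 0 := by simpa [hρ] using hc1'
      exact ⟨s' / s, by ext <;> simp [hs, hw']⟩
    · have h3 : (2 * ρ) * (w * t' - w' * t) ^ 2 = 0 := by
        linear_combination (2 * t' ^ 2) * hc1 + (2 * t ^ 2) * hc1' - 4 * t * t' * h
      have h4 : w * t' = w' * t := by
        simpa [h2, hρ, sub_eq_zero] using h3
      refine ⟨t' / t, ?_⟩
      have hs : 2 * t * (s' * t) = 2 * t * (t' * s) := by
        linear_combination (2 * t) * h - (2 * t') * hc1 + (2 * ρ * w) * h4
      ext
      · have := mul_left_cancel₀ (by simp [h2, ht]) hs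
        simp
        field_simp
        linear_combination this
      · simp [ht]
      · simp
        field_simp
        linear_combination -h4
  · have hcharE := FiniteField.ringChar_ne_two_of_card_mod_four hE
    have h3 := sum_comp_sq hcharE (fun v : E => if Algebra.trace K E v = 1 then (1 : ℤ) else 0)
    have h4 : ∑ z : E, (if Algebra.trace K E (z ^ 2) = 1 then (1 : ℤ) else 0) =
        Fintype.card K ^ 2 + Fintype.card K * quadraticChar K ρ := by
      rw [← φ.sum_comp, ← card_hyperbolic_eq_one hK hρ]
      simp only [sq, hφ]
    have h5 : ∑ v : E, (if Algebra.trace K E v = 1 then (1 : ℤ) else 0) = Fintype.card K ^ 2 := by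
      rw [Finset.sum_boole]
      have h6 := card_fiber_mul_card (Algebra.trace K E) (Algebra.trace_ne_zero K E) 1
      rw [Module.card_eq_pow_finrank (K := K) (V := E), hd] at h6
      have h7 := Nat.eq_of_mul_eq_mul_right Fintype.card_pos
        (h6.trans (pow_succ (Fintype.card K) 2))
      exact_mod_cast h7
    have h6 : ε * quadraticChar K 2 = -quadraticChar K ρ := by
      simp only [ε]
      rw [neg_mul, quadraticChar_neg_of_card_mod_four hK, map_mul]
      linear_combination (-quadraticChar K ρ) * quadraticChar_mul_self_of_ne_zero h2
    have h7 : ∀ v : E, (if Algebra.trace K E v = 1 then 1 + quadraticChar E v else 0) =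
        (if Algebra.trace K E v = 1 then (1 : ℤ) else 0) +
          if Algebra.trace K E v = 1 then quadraticChar E v else 0 := by
      intro v
      split_ifs <;> simp
    simp only [mul_ite, mul_one, mul_zero, h7, Finset.sum_add_distrib, h4, h5] at h3
    linear_combination -h3 + (Fintype.card K : ℤ) * h6

end ConeSign

section ConeSums

variable {K E : Type*} [Field K] [Fintype K] [Field E] [Fintype E] [Algebra K E]

theorem sum_quadraticChar_trace_mul_eq (hE : Fintype.card E % 4 = 3)
    (hd : Odd (Module.finrank K E)) {c : E} (hc : c ≠ 0) (k : K) :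
    ∑ a : E, (if Algebra.trace K E (c * a) = k then quadraticChar E a else 0) =
      quadraticChar K k * quadraticChar E c *
        ∑ v : E, (if Algebra.trace K E v = 1 then quadraticChar E v else 0) := by
  by_cases hk : k = 0
  · subst hk
    rw [quadraticChar_zero, zero_mul, zero_mul]
    refine sum_eq_zero_of_odd (Equiv.neg E) _ fun a => ?_
    simp only [Equiv.neg_apply, mul_neg, map_neg, neg_eq_zero,
      quadraticChar_neg_of_card_mod_four hE]
    split_ifs <;> simp
  · have hkE : algebraMap K E k ≠ 0 := by simpa using hk
    let e : E ≃ E := Equiv.mulLeft₀ (algebraMap K E k * c⁻¹) (mul_ne_zero hkE (inv_ne_zero hc))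
    rw [← Equiv.sum_comp e, Finset.mul_sum]
    refine Finset.sum_congr rfl fun v _ => ?_
    have h1 : c * (algebraMap K E k * c⁻¹ * v) = k • v := by
      rw [Algebra.smul_def]; field_simp
    simp only [e, Equiv.mulLeft₀_apply, h1, map_smul, smul_eq_mul, map_mul, quadraticChar_inv_apply,
      quadraticChar_algebraMap_of_odd_finrank hd, mul_eq_left₀ hk, mul_ite, mul_zero]

theorem card_isotropic (hE : Fintype.card E % 4 = 3) (hd : Module.finrank K E = 3) :
    (Finset.univ.filter fun c : E => Algebra.trace K E (c * c) = 0).card =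
      Fintype.card K ^ 2 := by
  have h1 := sum_comp_sq (FiniteField.ringChar_ne_two_of_card_mod_four hE)
    (fun v : E => if Algebra.trace K E v = 0 then (1 : ℤ) else 0)
  have h2 : ∑ v : E, (if Algebra.trace K E v = 0 then quadraticChar E v else 0) = 0 := by
    refine sum_eq_zero_of_odd (Equiv.neg E) _ fun a => ?_
    simp only [Equiv.neg_apply, map_neg, neg_eq_zero, quadraticChar_neg_of_card_mod_four hE]
    split_ifs <;> simp
  have h3 := card_fiber_mul_card (Algebra.trace K E) (Algebra.trace_ne_zero K E) 0
  rw [Module.card_eq_pow_finrank (K := K) (V := E), hd] at h3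
  have h4 := Nat.eq_of_mul_eq_mul_right Fintype.card_pos
    (h3.trans (pow_succ (Fintype.card K) 2))
  have h5 : ∀ v : E, (if Algebra.trace K E v = 0 then 1 + quadraticChar E v else 0) =
      (if Algebra.trace K E v = 0 then (1 : ℤ) else 0) +
        if Algebra.trace K E v = 0 then quadraticChar E v else 0 := by
    intro v
    split_ifs <;> simp
  simp only [mul_ite, mul_one, mul_zero, h5, Finset.sum_add_distrib, h2, Finset.sum_boole, sq,
    add_zero] at h1
  have h6 := h4
  rw [← h6]
  exact_mod_cast h1

namespace IsConeSign

variable {sgn : E → ℤ} {ε : ℤ}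

theorem map_zero (h : IsConeSign (K := K) sgn ε) : sgn 0 = 0 := by
  by_contra h0
  exact ((h.ne_zero_iff 0).1 h0).1 rfl

theorem map_neg (h : IsConeSign (K := K) sgn ε) (hK : Fintype.card K % 4 = 3) (c : E) :
    sgn (-c) = -sgn c := by
  have h1 := h.smul (-1) c
  rwa [neg_smul, one_smul, quadraticChar_neg_of_card_mod_four hK, map_one, neg_one_mul] at h1

theorem card_trace_ne_zero (h : IsConeSign (K := K) sgn ε) (hE : Fintype.card E % 4 = 3)
    (hd : Module.finrank K E = 3) {c : E} (hc : sgn c ≠ 0) :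
    ((Finset.univ.filter fun x : E => sgn x ≠ 0 ∧ Algebra.trace K E (c * x) ≠ 0).card : ℤ) =
      Fintype.card K ^ 2 - Fintype.card K := by
  obtain ⟨hc0, hcc⟩ := (h.ne_zero_iff c).1 hc
  have h1 : (Finset.univ.filter fun x : E => Algebra.trace K E (x * x) = 0) =
      (Finset.univ.filter fun x : E => sgn x ≠ 0 ∧ Algebra.trace K E (c * x) ≠ 0) ∪
        Finset.univ.image fun k : K => k • c := by
    ext x
    simp only [Finset.mem_filter, Finset.mem_univ, true_and, Finset.mem_union, Finset.mem_image]
    constructor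
    · intro hx
      by_cases hx0 : x = 0
      · exact Or.inr ⟨0, by simp [hx0]⟩
      · have hs := (h.ne_zero_iff x).2 ⟨hx0, hx⟩
        by_cases ht : Algebra.trace K E (c * x) = 0
        · obtain ⟨k, hk⟩ := h.exists_smul c x hc hs ht
          exact Or.inr ⟨k, hk.symm⟩
        · exact Or.inl ⟨hs, ht⟩
    · rintro (hx | ⟨k, rfl⟩)
      · exact ((h.ne_zero_iff x).1 hx.1).2
      · rw [smul_mul_smul_comm, map_smul, hcc, smul_zero]
  have h2 : Disjoint
      (Finset.univ.filter fun x : E => sgn x ≠ 0 ∧ Algebra.trace K E (c * x) ≠ 0)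
      (Finset.univ.image fun k : K => k • c) := by
    rw [Finset.disjoint_left]
    rintro x hx hx'
    obtain ⟨k, -, rfl⟩ := Finset.mem_image.1 hx'
    apply (Finset.mem_filter.1 hx).2.2
    rw [mul_smul_comm, map_smul, hcc, smul_zero]
  have h3 : (Finset.univ.image fun k : K => k • c).card = Fintype.card K :=
    Finset.card_image_of_injective _ (smul_left_injective K hc0)
  have h4 := card_isotropic (K := K) hE hd
  rw [h1, Finset.card_union_of_disjoint h2, h3] at h4
  rw [eq_sub_iff_add_eq]
  exact_mod_cast h4

theorem sum_mul_quadraticChar_trace (h : IsConeSign (K := K) sgn ε)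
    (hE : Fintype.card E % 4 = 3) (hd : Module.finrank K E = 3) {c : E} (hc : sgn c ≠ 0) :
    ∑ x : E, sgn x * quadraticChar K (Algebra.trace K E (c * x)) =
      ε * sgn c * (Fintype.card K ^ 2 - Fintype.card K) := by
  rw [← h.card_trace_ne_zero hE hd hc, ← Finset.sum_boole, Finset.mul_sum]
  refine Finset.sum_congr rfl fun x _ => ?_
  split_ifs with hx
  · have h1 := h.mul_eq c x hc hx.1 hx.2
    linear_combination (-sgn x * quadraticChar K (Algebra.trace K E (c * x))) * h.eps_mul_self
      - (ε * sgn x) * h1 + (ε * sgn c) * h.mul_self x hx.1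
  · by_cases h0 : sgn x = 0
    · simp [h0]
    · have h1 : Algebra.trace K E (c * x) = 0 := by
        by_contra h1
        exact hx ⟨h0, h1⟩
      simp [h1]

theorem sum_quadraticChar_mul (h : IsConeSign (K := K) sgn ε) (hK : Fintype.card K % 4 = 3)
    (hE : Fintype.card E % 4 = 3) (hd : Module.finrank K E = 3) {c : E} (hc : sgn c ≠ 0) :
    ∑ a : E, ∑ b : E, quadraticChar E a *
        (if Algebra.trace K E (c * a) = Algebra.trace K E (c * b) then sgn (a + b) else 0) =
      -((Fintype.card K : ℤ) ^ 2 * (Fintype.card K - 1) * (quadraticChar E c * sgn c)) := by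
  have h2 := FiniteField.two_ne_zero_of_card_mod_four hK
  have hc0 := ((h.ne_zero_iff c).1 hc).1
  have hodd : Odd (Module.finrank K E) := by rw [hd]; decide
  have h1 : ∀ a : E, ∑ b : E, quadraticChar E a *
        (if Algebra.trace K E (c * a) = Algebra.trace K E (c * b) then sgn (a + b) else 0) =
      ∑ x : E, sgn x * (if Algebra.trace K E (c * a) = Algebra.trace K E (c * x) / 2 then
        quadraticChar E a else 0) := by
    intro a
    rw [← (Equiv.subRight a).sum_comp]
    refine Finset.sum_congr rfl fun x _ => ?_
    have h3 : Algebra.trace K E (c * a) = Algebra.trace K E (c * (x - a)) ↔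
        Algebra.trace K E (c * a) = Algebra.trace K E (c * x) / 2 := by
      rw [mul_sub, map_sub, eq_div_iff h2]
      constructor <;> intro h4 <;> linear_combination h4
    simp only [Equiv.subRight_apply, h3, add_sub_cancel]
    split_ifs <;> ring
  rw [Finset.sum_congr rfl (fun a _ => h1 a), Finset.sum_comm]
  simp_rw [← Finset.mul_sum, sum_quadraticChar_trace_mul_eq hE hodd hc0, h.sum_trace_one]
  have h4 := h.sum_mul_quadraticChar_trace hE hd hc
  have h5 : ∀ x : E, sgn x * (quadraticChar K (Algebra.trace K E (c * x) / 2) * quadraticChar E c *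
      -(Fintype.card K * ε * quadraticChar K 2)) =
      (-(Fintype.card K * ε * quadraticChar E c)) *
        (sgn x * quadraticChar K (Algebra.trace K E (c * x))) := by
    intro x
    rw [div_eq_mul_inv, map_mul, quadraticChar_inv_apply]
    linear_combination (-(sgn x * quadraticChar K (Algebra.trace K E (c * x)) * quadraticChar E c *
      Fintype.card K * ε)) * quadraticChar_mul_self_of_ne_zero h2
  rw [Finset.sum_congr rfl (fun x _ => h5 x), ← Finset.mul_sum, h4]
  linear_combination (-(Fintype.card K * quadraticChar E c * sgn c *
    (Fintype.card K ^ 2 - Fintype.card K))) * h.eps_mul_self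

theorem sum_sq_add_sq (h : IsConeSign (K := K) sgn ε) (hK : Fintype.card K % 4 = 3)
    (hE : Fintype.card E % 4 = 3) (hd : Module.finrank K E = 3) {c : E} (hc : sgn c ≠ 0) :
    ∑ a : E, ∑ b : E, (if Algebra.trace K E (c * a ^ 2) = Algebra.trace K E (c * b ^ 2) then
        sgn (a ^ 2 + b ^ 2) else 0) =
      -(2 * ((Fintype.card K : ℤ) ^ 2 * (Fintype.card K - 1) * (quadraticChar E c * sgn c))) := by
  have hchar := FiniteField.ringChar_ne_two_of_card_mod_four hE
  let G : E → E → ℤ := fun a b =>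
    if Algebra.trace K E (c * a) = Algebra.trace K E (c * b) then sgn (a + b) else 0
  have hG : ∀ a b, G (-a) (-b) = -G a b := by
    intro a b
    simp only [G, mul_neg, _root_.map_neg, neg_inj, ← neg_add, h.map_neg hK]
    split_ifs <;> simp
  have hG' : ∀ a b, G a b = G b a := by
    intro a b
    simp only [G, add_comm a b, eq_comm]
  have h0 := h.sum_quadraticChar_mul hK hE hd hc
  change ∑ a, ∑ b, quadraticChar E a * G a b = _ at h0
  change ∑ a, ∑ b, G (a ^ 2) (b ^ 2) = _
  have h1 : ∀ a : E, ∑ b, G (a ^ 2) (b ^ 2) = ∑ b, (1 + quadraticChar E b) * G (a ^ 2) b :=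
    fun a => sum_comp_sq hchar (fun b => G (a ^ 2) b)
  have h2 : ∑ a : E, ∑ b, (1 + quadraticChar E b) * G (a ^ 2) b =
      ∑ a, (1 + quadraticChar E a) * ∑ b, (1 + quadraticChar E b) * G a b :=
    sum_comp_sq hchar (fun a => ∑ b, (1 + quadraticChar E b) * G a b)
  rw [Finset.sum_congr rfl (fun a _ => h1 a), h2]
  have h3 : ∑ x : E × E, G x.1 x.2 = 0 :=
    sum_eq_zero_of_odd (Equiv.neg (E × E)) _ fun x => hG x.1 x.2
  have h4 : ∑ x : E × E, quadraticChar E x.1 * quadraticChar E x.2 * G x.1 x.2 = 0 :=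
    sum_eq_zero_of_odd (Equiv.neg (E × E)) _ fun x => by
      simp only [Equiv.neg_apply, Prod.fst_neg, Prod.snd_neg, hG,
        quadraticChar_neg_of_card_mod_four hE]
      ring
  have h5 : ∑ a, ∑ b, quadraticChar E b * G a b = ∑ a, ∑ b, quadraticChar E a * G a b := by
    rw [Finset.sum_comm]
    simp only [hG']
  rw [Fintype.sum_prod_type] at h3 h4
  simp_rw [Finset.mul_sum, ← mul_assoc, add_mul, mul_add, add_mul, Finset.sum_add_distrib,
    one_mul, mul_one]
  rw [h3, h4, h0, h5, h0]
  ring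

/-- A cone sign is invariant under automorphisms of order three. -/
theorem map_algEquiv (h : IsConeSign (K := K) sgn ε) (σ : E ≃ₐ[K] E)
    (hσ : ∀ x, σ (σ (σ x)) = x) (c : E) : sgn (σ c) = sgn c := by
  have htr : ∀ x, Algebra.trace K E (σ x) = Algebra.trace K E x :=
    fun x => Algebra.trace_eq_of_algEquiv σ x
  have hne : ∀ x, sgn (σ x) ≠ 0 ↔ sgn x ≠ 0 := by
    intro x
    rw [h.ne_zero_iff, h.ne_zero_iff, ← map_mul, htr, map_ne_zero_iff σ σ.injective]
  by_cases hc : sgn c = 0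
  · rw [hc]
    by_contra h1
    exact (hne c).1 h1 hc
  have hc1 := (hne c).2 hc
  have hc2 := (hne _).2 hc1
  have hm := h.mul_self c hc
  have hm1 := h.mul_self _ hc1
  by_cases ht : Algebra.trace K E (c * σ c) = 0
  · obtain ⟨k, hk⟩ := h.exists_smul c _ hc hc1 ht
    have hc0 := ((h.ne_zero_iff c).1 hc).1
    have h3 := hσ c
    simp only [hk, map_smul, smul_smul] at h3
    have hk3 : k * k * k = 1 := by
      have h4 : (k * k * k - 1) • c = 0 := by rw [sub_smul, one_smul, h3, sub_self]
      exact sub_eq_zero.1 ((smul_eq_zero.1 h4).resolve_right hc0)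
    have hk0 : k ≠ 0 := by rintro rfl; simp at hk3
    have h5 := congrArg (quadraticChar K) hk3
    rw [map_mul, map_mul, quadraticChar_mul_self_of_ne_zero hk0, one_mul, map_one] at h5
    rw [hk, h.smul, h5, one_mul]
  · have ht1 : Algebra.trace K E (σ c * σ (σ c)) = Algebra.trace K E (c * σ c) := by
      rw [← map_mul, htr]
    have ht2 : Algebra.trace K E (σ (σ c) * c) = Algebra.trace K E (c * σ c) := by
      rw [← ht1, ← htr (σ c * _), map_mul σ, hσ]
    have e0 := h.mul_eq c _ hc hc1 ht
    have e1 := h.mul_eq _ _ hc1 hc2 (by rwa [ht1])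
    have e2 := h.mul_eq _ _ hc2 hc (by rwa [ht2])
    rw [ht1, ← e0] at e1
    rw [ht2, ← e0] at e2
    have hm2 := h.mul_self _ hc2
    have e3 : sgn (σ (σ c)) = sgn (σ c) :=
      calc sgn (σ (σ c)) = sgn (σ (σ c)) * (sgn c * sgn c) := by rw [hm, mul_one]
        _ = (sgn (σ (σ c)) * sgn c) * sgn c := by ring
        _ = sgn (σ c) := by rw [e2, mul_comm (sgn c), mul_assoc, hm, mul_one]
    rw [e3, hm1] at e1
    calc sgn (σ c) = sgn (σ c) * (sgn c * sgn c) := by rw [hm, mul_one]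
      _ = (sgn c * sgn (σ c)) * sgn c := by ring
      _ = sgn c := by rw [← e1, one_mul]

end IsConeSign

end ConeSums

section Gaussian

variable {E L : Type*} [Field E] [Field L] [Algebra E L]

/-- `re` and `im` are the coordinates of `L` over `E` with respect to `1` and a square root `i`
of `-1`. -/
structure IsGaussian (re im : L →ₗ[E] E) (i : L) : Prop where
  mul_self : i * i = -1
  re_add_im : ∀ x, algebraMap E L (re x) + algebraMap E L (im x) * i = x
  re_mk : ∀ a b, re (algebraMap E L a + algebraMap E L b * i) = a
  im_mk : ∀ a b, im (algebraMap E L a + algebraMap E L b * i) = b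

theorem exists_isGaussian [Fintype E] [Fintype L] (hE : Fintype.card E % 4 = 3)
    (hL : Fintype.card L = Fintype.card E ^ 2) :
    ∃ (re im : L →ₗ[E] E) (i : L), IsGaussian re im i := by
  have hL4 : Fintype.card L % 4 ≠ 3 := by
    rw [hL, Nat.pow_mod, hE]; decide
  obtain ⟨i, hi⟩ := FiniteField.isSquare_neg_one_iff.2 hL4
  have hiE : ∀ a : E, algebraMap E L a ≠ i := by
    rintro a rfl
    rw [← map_mul, ← map_one (algebraMap E L), ← map_neg] at hi
    exact FiniteField.isSquare_neg_one_iff.1 ⟨a, (algebraMap E L).injective hi⟩ hE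
  let g : E × E →ₗ[E] L := (Algebra.linearMap E L).coprod ((LinearMap.toSpanSingleton E L i))
  have hg : ∀ a b, g (a, b) = algebraMap E L a + algebraMap E L b * i := by
    intro a b
    simp [g, Algebra.smul_def]
  have hinj : Function.Injective g := by
    rw [injective_iff_map_eq_zero]
    rintro ⟨a, b⟩ h
    rw [hg] at h
    by_cases hb : b = 0
    · subst hb
      simpa using h
    · refine absurd ?_ (hiE (-a / b))
      have hb' : algebraMap E L b ≠ 0 := by simpa using hb
      rw [map_div₀, map_neg, div_eq_iff hb']
      linear_combination -h
  have hbij : Function.Bijective g :=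
    (Fintype.bijective_iff_injective_and_card g).2 ⟨hinj, by rw [hL, Fintype.card_prod, sq]⟩
  let e := LinearEquiv.ofBijective g hbij
  have he : ∀ a b, e.symm (algebraMap E L a + algebraMap E L b * i) = (a, b) := by
    intro a b
    rw [← hg]
    exact e.symm_apply_apply (a, b)
  refine ⟨(LinearMap.fst E E E).comp e.symm.toLinearMap,
    (LinearMap.snd E E E).comp e.symm.toLinearMap, i, hi.symm, ?_, ?_, ?_⟩
  · intro x
    obtain ⟨⟨a, b⟩, rfl⟩ := hbij.2 x
    rw [hg]
    simp [he]
  · intro a b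
    simp [he]
  · intro a b
    simp [he]

/-- The multiplicative map `x ↦ x ^ ((|E| + 1) / 2)`, a square root of the norm. -/
def halfNorm (E : Type*) {L : Type*} [Fintype E] [Field L] : L →* L :=
  powMonoidHom ((Fintype.card E + 1) / 2)

theorem halfNorm_apply (E : Type*) {L : Type*} [Fintype E] [Field L] (x : L) :
    halfNorm E x = x ^ ((Fintype.card E + 1) / 2) := rfl

theorem card_div_two_of_eq_sq {E L : Type*} [Fintype E] [Fintype L]
    (hE : Fintype.card E % 4 = 3)
    (hL : Fintype.card L = Fintype.card E ^ 2) :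
    Fintype.card L / 2 = (Fintype.card E + 1) / 2 * (Fintype.card E - 1) := by
  rw [hL]
  generalize Fintype.card E = n at hE
  obtain ⟨m, rfl⟩ : ∃ m, n = 2 * m + 1 := ⟨n / 2, by omega⟩
  have h1 : (2 * m + 1 + 1) / 2 = m + 1 := by omega
  have h2 : 2 * m + 1 - 1 = 2 * m := by omega
  have h3 : (2 * m + 1) ^ 2 = 2 * ((m + 1) * (2 * m)) + 1 := by ring
  rw [h1, h2, h3]
  omega

theorem halfNorm_pow_card_sub_one {E L : Type*} [Fintype E] [Field L] [Fintype L]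
    (hE : Fintype.card E % 4 = 3)
    (hL : Fintype.card L = Fintype.card E ^ 2) (x : L) :
    halfNorm E x ^ (Fintype.card E - 1) = (quadraticChar L x : L) := by
  have hchar : ringChar L ≠ 2 := by
    intro h1
    have h2 := FiniteField.even_card_iff_char_two.1 h1
    rw [hL, Nat.pow_mod] at h2
    have h3 : Fintype.card E % 2 = 1 := by omega
    rw [h3] at h2
    exact absurd h2 (by decide)
  rw [quadraticChar_eq_pow_of_char_ne_two' hchar, halfNorm_apply, ← pow_mul, card_div_two_of_eq_sq hE hL]

theorem halfNorm_algebraMap [Fintype E] (hE : Fintype.card E % 4 = 3) (a : E) :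
    halfNorm E (algebraMap E L a) = algebraMap E L ((quadraticChar E a : E) * a) := by
  rw [quadraticChar_eq_pow_of_char_ne_two' (FiniteField.ringChar_ne_two_of_card_mod_four hE),
    halfNorm_apply, ← map_pow, ← pow_succ]
  congr 2
  omega

namespace IsGaussian

variable {re im : L →ₗ[E] E} {i : L}

theorem ext (h : IsGaussian re im i) {x y : L} (h1 : re x = re y) (h2 : im x = im y) : x = y := by
  rw [← h.re_add_im x, ← h.re_add_im y, h1, h2]

/-- The coordinates of `L` over `E` as an equivalence. -/
noncomputable def coordEquiv (h : IsGaussian re im i) : E × E ≃ L where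
  toFun p := algebraMap E L p.1 + algebraMap E L p.2 * i
  invFun x := (re x, im x)
  left_inv p := Prod.ext (h.re_mk p.1 p.2) (h.im_mk p.1 p.2)
  right_inv x := h.re_add_im x

theorem re_algebraMap (h : IsGaussian re im i) (a : E) : re (algebraMap E L a) = a := by
  simpa using h.re_mk a 0

theorem im_algebraMap (h : IsGaussian re im i) (a : E) : im (algebraMap E L a) = 0 := by
  simpa using h.im_mk a 0

theorem mul_eq (h : IsGaussian re im i) (x y : L) :
    x * y = algebraMap E L (re x * re y - im x * im y) +
      algebraMap E L (re x * im y + im x * re y) * i := by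
  conv_lhs => rw [← h.re_add_im x, ← h.re_add_im y]
  simp only [map_sub, map_add, map_mul]
  linear_combination (algebraMap E L (im x) * algebraMap E L (im y)) * h.mul_self

theorem re_mul (h : IsGaussian re im i) (x y : L) : re (x * y) = re x * re y - im x * im y := by
  rw [h.mul_eq, h.re_mk]

theorem im_mul (h : IsGaussian re im i) (x y : L) : im (x * y) = re x * im y + im x * re y := by
  rw [h.mul_eq, h.im_mk]

theorem re_i (h : IsGaussian re im i) : re i = 0 := by simpa using h.re_mk 0 1

theorem im_i (h : IsGaussian re im i) : im i = 1 := by simpa using h.im_mk 0 1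

variable [Fintype E]

theorem pow_card (h : IsGaussian re im i) (hE : Fintype.card E % 4 = 3) (x : L) :
    x ^ Fintype.card E = algebraMap E L (re x) - algebraMap E L (im x) * i := by
  have h1 : i ^ Fintype.card E = -i := by
    rw [← Nat.div_add_mod (Fintype.card E) 4, hE, pow_add, pow_mul]
    have h2 : i ^ 4 = 1 := by linear_combination (i * i - 1) * h.mul_self
    rw [h2, one_pow]
    linear_combination i * h.mul_self
  have h2 := map_add (FiniteField.frobeniusAlgHom E L) (algebraMap E L (re x))
    (algebraMap E L (im x) * i)
  rw [map_mul, AlgHom.commutes, AlgHom.commutes, h.re_add_im] at h2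
  simp only [FiniteField.coe_frobeniusAlgHom, h1] at h2
  rw [h2]
  ring

theorem re_pow_card (h : IsGaussian re im i) (hE : Fintype.card E % 4 = 3) (x : L) :
    re (x ^ Fintype.card E) = re x := by
  rw [h.pow_card hE, sub_eq_add_neg, ← neg_mul, ← map_neg, h.re_mk]

theorem im_pow_card (h : IsGaussian re im i) (hE : Fintype.card E % 4 = 3) (x : L) :
    im (x ^ Fintype.card E) = -im x := by
  rw [h.pow_card hE, sub_eq_add_neg, ← neg_mul, ← map_neg, h.im_mk]

theorem pow_card_add_one (h : IsGaussian re im i) (hE : Fintype.card E % 4 = 3) (x : L) :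
    x ^ (Fintype.card E + 1) = algebraMap E L (re x * re x + im x * im x) := by
  apply h.ext
  · rw [pow_succ, h.re_mul, h.re_pow_card hE, h.im_pow_card hE, h.re_algebraMap]
    ring
  · rw [pow_succ, h.im_mul, h.re_pow_card hE, h.im_pow_card hE, h.im_algebraMap]
    ring

theorem halfNorm_sq (h : IsGaussian re im i) (hE : Fintype.card E % 4 = 3) (x : L) :
    halfNorm E x * halfNorm E x = algebraMap E L (re x * re x + im x * im x) := by
  rw [← h.pow_card_add_one hE, halfNorm_apply, ← pow_add]
  congr 1
  omega

variable [Fintype L]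

theorem halfNorm_cases (h : IsGaussian re im i) (hE : Fintype.card E % 4 = 3)
    (hL : Fintype.card L = Fintype.card E ^ 2) {x : L} (hx : x ≠ 0) :
    ∃ c : E, c ≠ 0 ∧
      ((quadraticChar L x = 1 ∧ halfNorm E x = algebraMap E L c ∧
          re x * re x + im x * im x = c * c) ∨
        (quadraticChar L x = -1 ∧ halfNorm E x = algebraMap E L c * i ∧
          re x * re x + im x * im x = -(c * c))) := by
  have h2 := FiniteField.two_ne_zero_of_card_mod_four hE
  have hn : halfNorm E x ≠ 0 := by rw [halfNorm_apply]; exact pow_ne_zero _ hx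
  have h1 : halfNorm E x ^ Fintype.card E = (quadraticChar L x : L) * halfNorm E x := by
    rw [← halfNorm_pow_card_sub_one hE hL x, ← pow_succ]
    congr 1
    have := Fintype.card_pos (α := E)
    omega
  have hre := h.re_pow_card hE (halfNorm E x)
  have him := h.im_pow_card hE (halfNorm E x)
  have hsq := h.halfNorm_sq hE x
  have hmk := h.re_add_im (halfNorm E x)
  rw [h1] at hre him
  rcases quadraticChar_dichotomy hx with hq | hq
  · rw [hq, Int.cast_one, one_mul] at him
    have h0 : im (halfNorm E x) = 0 := by
      have : 2 * im (halfNorm E x) = 0 := by linear_combination him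
      simpa [h2] using this
    rw [h0, _root_.map_zero, zero_mul, add_zero] at hmk
    refine ⟨re (halfNorm E x), ?_, Or.inl ⟨hq, hmk.symm, ?_⟩⟩
    · intro h3
      rw [h3, _root_.map_zero] at hmk
      exact hn hmk.symm
    · rw [← hmk, ← map_mul] at hsq
      exact ((algebraMap E L).injective hsq).symm
  · rw [hq, Int.cast_neg, Int.cast_one, neg_one_mul, map_neg] at hre
    have h0 : re (halfNorm E x) = 0 := by
      have : 2 * re (halfNorm E x) = 0 := by linear_combination -hre
      simpa [h2] using this
    rw [h0, _root_.map_zero, zero_add] at hmk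
    refine ⟨im (halfNorm E x), ?_, Or.inr ⟨hq, hmk.symm, ?_⟩⟩
    · intro h3
      rw [h3, _root_.map_zero, zero_mul] at hmk
      exact hn hmk.symm
    · rw [← hmk, mul_mul_mul_comm, h.mul_self, mul_neg_one, ← map_mul, ← map_neg] at hsq
      exact ((algebraMap E L).injective hsq).symm

end IsGaussian

end Gaussian

set_option linter.unusedSectionVars false

section HemiSign

variable {K E L : Type*} [Field K] [Fintype K] [Field E] [Fintype E] [Field L] [Fintype L]
  [Algebra K E] [Algebra E L] [Algebra K L] [IsScalarTower K E L]

/-- The sign of the half norm of `x`, whose real or imaginary part vanishes. -/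
noncomputable def hemiSign (sgn : E → ℤ) (re im : L →ₗ[E] E) (x : L) : ℤ :=
  sgn (re (halfNorm E x) + im (halfNorm E x))

/-- Half the polar form of the quadratic form `x ↦ Tr (x ^ (|E| + 1))`. -/
noncomputable def polarForm (K : Type*) [Field K] [Algebra K E] [Algebra K L] [IsScalarTower K E L]
    (re im : L →ₗ[E] E) : L →ₗ[K] L →ₗ[K] K :=
  LinearMap.mk₂ K (fun x y => Algebra.trace K E (re x * re y + im x * im y))
    (fun x x' y => by rw [← map_add, map_add re, map_add im]; congr 1; ring)
    (fun k x y => by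
      rw [← map_smul, LinearMap.map_smul_of_tower, LinearMap.map_smul_of_tower, smul_add,
        smul_mul_assoc, smul_mul_assoc])
    (fun x y y' => by rw [← map_add, map_add re, map_add im]; congr 1; ring)
    (fun k x y => by
      rw [← map_smul, LinearMap.map_smul_of_tower, LinearMap.map_smul_of_tower, smul_add,
        mul_smul_comm, mul_smul_comm])

theorem polarForm_apply (re im : L →ₗ[E] E) (x y : L) :
    polarForm K re im x y = Algebra.trace K E (re x * re y + im x * im y) := rfl

theorem polarForm_comm (re im : L →ₗ[E] E) (x y : L) :
    polarForm K re im x y = polarForm K re im y x := by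
  rw [polarForm_apply, polarForm_apply, mul_comm (re x), mul_comm (im x)]

/-- The standing assumptions: `L / E / K` are finite fields of relative degrees `2` and `3` with
`|K| ≡ 3 (mod 4)`, together with coordinates on `L` and a sign function on `E`. -/
structure IsHemiData (K : Type*) {E L : Type*} [Field K] [Fintype K] [Field E] [Fintype E]
    [Field L] [Fintype L] [Algebra K E] [Algebra E L]
    (sgn : E → ℤ) (ε : ℤ) (re im : L →ₗ[E] E) (i : L) : Prop where
  isConeSign : IsConeSign (K := K) sgn ε
  isGaussian : IsGaussian re im i
  card_mod_four : Fintype.card K % 4 = 3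
  finrank_eq : Module.finrank K E = 3
  card_eq : Fintype.card L = Fintype.card E ^ 2

namespace IsHemiData

variable {sgn : E → ℤ} {ε : ℤ} {re im : L →ₗ[E] E} {i : L}

theorem card_eq_pow (h : IsHemiData K sgn ε re im i) : Fintype.card E = Fintype.card K ^ 3 := by
  rw [Module.card_eq_pow_finrank (K := K) (V := E), h.finrank_eq]

theorem card_mod_four' (h : IsHemiData K sgn ε re im i) : Fintype.card E % 4 = 3 := by
  rw [h.card_eq_pow, Nat.pow_mod, h.card_mod_four]

theorem exists_sign (h : IsHemiData K sgn ε re im i) {x : L} (hx : x ≠ 0) :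
    ∃ c : E, c ≠ 0 ∧ hemiSign sgn re im x = sgn c ∧
      ((quadraticChar L x = 1 ∧ halfNorm E x = algebraMap E L c ∧
          re x * re x + im x * im x = c * c) ∨
        (quadraticChar L x = -1 ∧ halfNorm E x = algebraMap E L c * i ∧
          re x * re x + im x * im x = -(c * c))) := by
  have hg := h.isGaussian
  obtain ⟨c, hc, hcase⟩ := hg.halfNorm_cases h.card_mod_four' h.card_eq hx
  refine ⟨c, hc, ?_, hcase⟩
  rcases hcase with ⟨-, hn, -⟩ | ⟨-, hn, -⟩
  · rw [hemiSign, hn, hg.re_algebraMap, hg.im_algebraMap, add_zero]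
  · have h1 := hg.re_mk 0 c
    have h2 := hg.im_mk 0 c
    rw [map_zero, zero_add] at h1 h2
    rw [hemiSign, hn, h1, h2, zero_add]

theorem hemiSign_zero (h : IsHemiData K sgn ε re im i) : hemiSign sgn re im (0 : L) = 0 := by
  have := Fintype.card_pos (α := E)
  rw [hemiSign, halfNorm_apply, zero_pow (by omega), map_zero, map_zero, add_zero,
    h.isConeSign.map_zero]

theorem hemiSign_ne_zero_iff (h : IsHemiData K sgn ε re im i) (x : L) :
    hemiSign sgn re im x ≠ 0 ↔ x ≠ 0 ∧ polarForm K re im x x = 0 := by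
  by_cases hx : x = 0
  · simp [hx, h.hemiSign_zero]
  obtain ⟨c, hc, hs, hcase⟩ := h.exists_sign hx
  rw [hs, h.isConeSign.ne_zero_iff, polarForm_apply]
  rcases hcase with ⟨-, -, hn⟩ | ⟨-, -, hn⟩
  · simp [hc, hx, hn]
  · simp [hc, hx, hn]

theorem hemiSign_mul_self (h : IsHemiData K sgn ε re im i) {x : L}
    (hx : hemiSign sgn re im x ≠ 0) : hemiSign sgn re im x * hemiSign sgn re im x = 1 :=
  h.isConeSign.mul_self _ hx

theorem hemiSign_mul_of_halfNorm (h : IsHemiData K sgn ε re im i) {a : L} {k : K}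
    (ha : halfNorm E a = algebraMap K L k) (x : L) :
    hemiSign sgn re im (a * x) = quadraticChar K k * hemiSign sgn re im x := by
  rw [hemiSign, map_mul, ha, ← Algebra.smul_def, LinearMap.map_smul_of_tower,
    LinearMap.map_smul_of_tower, ← smul_add, h.isConeSign.smul, hemiSign]

theorem hemiSign_mul_of_halfNorm_eq_mul_i (h : IsHemiData K sgn ε re im i) {a : L} {k : K}
    (ha : halfNorm E a = algebraMap K L k * i) (x : L) :
    hemiSign sgn re im (a * x) =
      quadraticChar K k * (quadraticChar L x * hemiSign sgn re im x) := by
  by_cases hx : x = 0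
  · simp [hx, h.hemiSign_zero]
  have hg := h.isGaussian
  obtain ⟨c, hc, hs, hcase⟩ := h.exists_sign hx
  rw [hs, hemiSign, map_mul, ha, mul_assoc, ← Algebra.smul_def, LinearMap.map_smul_of_tower,
    LinearMap.map_smul_of_tower, ← smul_add, h.isConeSign.smul, hg.re_mul, hg.im_mul, hg.re_i,
    hg.im_i]
  rcases hcase with ⟨hq, hn, -⟩ | ⟨hq, hn, -⟩
  · rw [hq, hn, hg.re_algebraMap, hg.im_algebraMap]
    simp
  · have h1 := hg.re_mk 0 c
    have h2 := hg.im_mk 0 c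
    rw [map_zero, zero_add] at h1 h2
    rw [hq, hn, h1, h2]
    simp [h.isConeSign.map_neg h.card_mod_four]

theorem hemiSign_pow_card (h : IsHemiData K sgn ε re im i) (x : L) :
    hemiSign sgn re im (x ^ Fintype.card E) = quadraticChar L x * hemiSign sgn re im x := by
  by_cases hx : x = 0
  · have := Fintype.card_pos (α := E)
    simp [hx, h.hemiSign_zero, zero_pow this.ne']
  have hg := h.isGaussian
  obtain ⟨c, hc, hs, hcase⟩ := h.exists_sign hx
  rw [hs, hemiSign, map_pow, hg.re_pow_card h.card_mod_four', hg.im_pow_card h.card_mod_four']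
  rcases hcase with ⟨hq, hn, -⟩ | ⟨hq, hn, -⟩
  · rw [hq, hn, hg.re_algebraMap, hg.im_algebraMap]
    simp
  · have h1 := hg.re_mk 0 c
    have h2 := hg.im_mk 0 c
    rw [map_zero, zero_add] at h1 h2
    rw [hq, hn, h1, h2]
    simp [h.isConeSign.map_neg h.card_mod_four]

theorem odd_finrank (h : IsHemiData K sgn ε re im i) : Odd (Module.finrank K E) := by
  rw [h.finrank_eq]; decide

theorem hemiSign_smul (h : IsHemiData K sgn ε re im i) {k : K} (hk : k ≠ 0) (x : L) :
    hemiSign sgn re im (k • x) = hemiSign sgn re im x := by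
  have h1 : halfNorm E (algebraMap K L k) = algebraMap K L ((quadraticChar K k : K) * k) := by
    rw [IsScalarTower.algebraMap_apply K E L, halfNorm_algebraMap h.card_mod_four',
      quadraticChar_algebraMap_of_odd_finrank h.odd_finrank,
      IsScalarTower.algebraMap_apply K E L, map_mul, map_mul, map_mul]
    simp
  rw [Algebra.smul_def, h.hemiSign_mul_of_halfNorm h1, map_mul]
  rcases quadraticChar_dichotomy hk with hq | hq
  · simp [hq]
  · rw [hq, Int.cast_neg, Int.cast_one, quadraticChar_neg_of_card_mod_four h.card_mod_four, map_one]
    ring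

theorem hemiSign_sq (h : IsHemiData K sgn ε re im i) (z : L) :
    hemiSign sgn re im (z ^ 2) = sgn (re z * re z + im z * im z) := by
  rw [hemiSign, map_pow, sq, h.isGaussian.halfNorm_sq h.card_mod_four',
    h.isGaussian.re_algebraMap, h.isGaussian.im_algebraMap, add_zero]

theorem ringChar_ne_two (h : IsHemiData K sgn ε re im i) : ringChar L ≠ 2 := by
  intro h1
  have h2 := FiniteField.even_card_iff_char_two.1 h1
  rw [h.card_eq, Nat.pow_mod] at h2
  have h3 : Fintype.card E % 2 = 1 := by have := h.card_mod_four'; omega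
  rw [h3] at h2
  exact absurd h2 (by decide)

theorem sum_hemiSign_sq (h : IsHemiData K sgn ε re im i) {c : E} (hc : sgn c ≠ 0) :
    ∑ z : L, (if polarForm K re im (algebraMap E L c) (z ^ 2) = 0 then
        hemiSign sgn re im (z ^ 2) else 0) =
      -(2 * ((Fintype.card K : ℤ) ^ 2 * (Fintype.card K - 1) * (quadraticChar E c * sgn c))) := by
  have hg := h.isGaussian
  rw [← h.isConeSign.sum_sq_add_sq h.card_mod_four h.card_mod_four' h.finrank_eq hc,
    ← Equiv.sum_comp hg.coordEquiv, Fintype.sum_prod_type]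
  refine Finset.sum_congr rfl fun a _ => Finset.sum_congr rfl fun b _ => ?_
  have hre : re (hg.coordEquiv (a, b)) = a := hg.re_mk a b
  have him : im (hg.coordEquiv (a, b)) = b := hg.im_mk a b
  have h1 : polarForm K re im (algebraMap E L c) (hg.coordEquiv (a, b) ^ 2) = 0 ↔
      Algebra.trace K E (c * a ^ 2) = Algebra.trace K E (c * b ^ 2) := by
    rw [polarForm_apply, sq, hg.re_mul, hg.re_algebraMap, hg.im_algebraMap, hre, him, zero_mul,
      add_zero, mul_sub, map_sub, sub_eq_zero, sq, sq]
  simp only [h1, h.hemiSign_sq, hre, him]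
  simp only [sq]

/-- Raising to the power `|E|` as a permutation of `L`. -/
noncomputable def powCardEquiv (h : IsHemiData K sgn ε re im i) : L ≃ L :=
  Function.Involutive.toPerm (fun x => x ^ Fintype.card E) fun x => by
    change (x ^ Fintype.card E) ^ Fintype.card E = x
    rw [← pow_mul, ← sq, ← h.card_eq, FiniteField.pow_card]

theorem sum_quadraticChar_mul_hemiSign (h : IsHemiData K sgn ε re im i) (c : E) :
    ∑ x : L, (if polarForm K re im (algebraMap E L c) x = 0 then
        quadraticChar L x * hemiSign sgn re im x else 0) =
      ∑ x : L, (if polarForm K re im (algebraMap E L c) x = 0 then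
        hemiSign sgn re im x else 0) := by
  rw [← Equiv.sum_comp h.powCardEquiv (fun x : L => if polarForm K re im (algebraMap E L c) x = 0
    then hemiSign sgn re im x else 0)]
  refine Finset.sum_congr rfl fun x _ => ?_
  have h1 : polarForm K re im (algebraMap E L c) (x ^ Fintype.card E) =
      polarForm K re im (algebraMap E L c) x := by
    rw [polarForm_apply, polarForm_apply, h.isGaussian.re_pow_card h.card_mod_four',
      h.isGaussian.im_algebraMap, zero_mul, zero_mul]
  have h2 : h.powCardEquiv x = x ^ Fintype.card E := rfl
  simp only [h2, h1, h.hemiSign_pow_card]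

theorem sum_hemiSign_algebraMap (h : IsHemiData K sgn ε re im i) {c : E} (hc : sgn c ≠ 0) :
    ∑ x : L, (if polarForm K re im (algebraMap E L c) x = 0 then hemiSign sgn re im x else 0) =
      -((Fintype.card K : ℤ) ^ 2 * (Fintype.card K - 1) * (quadraticChar E c * sgn c)) := by
  have h1 := h.sum_hemiSign_sq hc
  rw [sum_comp_sq h.ringChar_ne_two (fun x => if polarForm K re im (algebraMap E L c) x = 0 then
    hemiSign sgn re im x else 0)] at h1
  have h2 := h.sum_quadraticChar_mul_hemiSign c
  simp only [add_mul, Finset.sum_add_distrib, mul_ite, mul_zero, one_mul, ite_add_zero, h2] at h1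
  linarith

theorem sum_hemiSign (h : IsHemiData K sgn ε re im i) :
    ∑ x : L, hemiSign sgn re im x = 0 := by
  obtain ⟨g, hg⟩ := FiniteField.exists_nonsquare h.ringChar_ne_two
  have hg0 : g ≠ 0 := by rintro rfl; simp at hg
  have h1 : halfNorm E (g ^ (Fintype.card E - 1)) = algebraMap K L (-1) := by
    rw [map_pow, halfNorm_pow_card_sub_one h.card_mod_four' h.card_eq,
      quadraticChar_neg_one_iff_not_isSquare.2 hg]
    simp
  refine sum_eq_zero_of_odd (Equiv.mulLeft₀ (g ^ (Fintype.card E - 1)) (pow_ne_zero _ hg0)) _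
    fun x => ?_
  rw [Equiv.mulLeft₀_apply, h.hemiSign_mul_of_halfNorm h1,
    quadraticChar_neg_of_card_mod_four h.card_mod_four, map_one, neg_one_mul]

/-- The signs of the isotropic vectors orthogonal to an isotropic vector `p` sum to a fixed
negative multiple of the sign of `p`. -/
theorem sum_hemiSign_orthogonal (h : IsHemiData K sgn ε re im i) {p : L}
    (hp : polarForm K re im p p = 0) :
    ∑ x : L, (if polarForm K re im p x = 0 then hemiSign sgn re im x else 0) =
      -((Fintype.card K : ℤ) ^ 2 * (Fintype.card K - 1) * hemiSign sgn re im p) := by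
  by_cases hp0 : p = 0
  · simp [hp0, h.hemiSign_zero, h.sum_hemiSign]
  have hg := h.isGaussian
  have hs0 := (h.hemiSign_ne_zero_iff p).2 ⟨hp0, hp⟩
  obtain ⟨c, hc, hs, hcase⟩ := h.exists_sign hp0
  rw [hs] at hs0 ⊢
  have hcL : algebraMap E L c ≠ 0 := by simpa using hc
  have hqc := quadraticChar_mul_self_of_ne_zero hc
  have hqcE : (quadraticChar E c : L) * quadraticChar E c = 1 := by
    rw [← Int.cast_mul, hqc, Int.cast_one]
  obtain ⟨a, rfl⟩ : ∃ a, p = a * algebraMap E L c := ⟨p / algebraMap E L c, by field_simp⟩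
  have ha0 : a ≠ 0 := left_ne_zero_of_mul hp0
  have hna : halfNorm E (a * algebraMap E L c) =
      halfNorm E a * ((quadraticChar E c : L) * algebraMap E L c) := by
    rw [map_mul, halfNorm_algebraMap h.card_mod_four', map_mul, map_intCast]
  have hN : re (a * algebraMap E L c) * re (a * algebraMap E L c) +
      im (a * algebraMap E L c) * im (a * algebraMap E L c) =
      (re a * re a + im a * im a) * (c * c) := by
    rw [hg.re_mul, hg.im_mul, hg.re_algebraMap, hg.im_algebraMap]
    ring
  have hB : ∀ y, polarForm K re im (a * algebraMap E L c) (a * y) =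
      Algebra.trace K E ((re a * re a + im a * im a) * (c * re y)) := by
    intro y
    rw [polarForm_apply]
    simp only [hg.re_mul, hg.im_mul, hg.re_algebraMap, hg.im_algebraMap]
    congr 1
    ring
  have hBc : ∀ y, polarForm K re im (algebraMap E L c) y = Algebra.trace K E (c * re y) := by
    intro y
    rw [polarForm_apply, hg.re_algebraMap, hg.im_algebraMap, zero_mul, add_zero]
  have hqχ : quadraticChar K (quadraticChar E c : K) = quadraticChar E c := by
    rcases quadraticChar_dichotomy hc with hq | hq <;> rw [hq]
    · simp
    · rw [Int.cast_neg, Int.cast_one, quadraticChar_neg_of_card_mod_four h.card_mod_four, map_one]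
  have hfin : ∀ y : L, quadraticChar E c *
      -((Fintype.card K : ℤ) ^ 2 * (Fintype.card K - 1) * (quadraticChar E c * sgn c)) =
      -((Fintype.card K : ℤ) ^ 2 * (Fintype.card K - 1) * sgn c) := by
    intro _
    linear_combination (-((Fintype.card K : ℤ) ^ 2 * (Fintype.card K - 1) * sgn c)) * hqc
  have hmain := h.sum_hemiSign_algebraMap hs0
  rw [← Equiv.sum_comp (Equiv.mulLeft₀ a ha0)]
  simp only [Equiv.mulLeft₀_apply]
  rcases hcase with ⟨hq, hn, hNn⟩ | ⟨hq, hn, hNn⟩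
  · have h1 : halfNorm E a = algebraMap K L (quadraticChar E c : K) := by
      rw [hna] at hn
      have h2 : halfNorm E a * (quadraticChar E c : L) = 1 := by
        apply mul_right_cancel₀ hcL
        linear_combination hn
      rw [map_intCast]
      linear_combination (quadraticChar E c : L) * h2 - halfNorm E a * hqcE
    have h3 : re a * re a + im a * im a = 1 := by
      rw [hN] at hNn
      exact mul_right_cancel₀ (mul_ne_zero hc hc) (hNn.trans (one_mul _).symm)
    simp only [hB, h3, one_mul, ← hBc, h.hemiSign_mul_of_halfNorm h1, hqχ]
    rw [← hfin 0, ← hmain, Finset.mul_sum]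
    simp only [mul_ite, mul_zero]
  · have h1 : halfNorm E a = algebraMap K L (quadraticChar E c : K) * i := by
      rw [hna] at hn
      have h2 : halfNorm E a * (quadraticChar E c : L) = i := by
        apply mul_right_cancel₀ hcL
        linear_combination hn
      rw [map_intCast]
      linear_combination (quadraticChar E c : L) * h2 - halfNorm E a * hqcE
    have h3 : re a * re a + im a * im a = -1 := by
      rw [hN] at hNn
      exact mul_right_cancel₀ (mul_ne_zero hc hc) (hNn.trans (neg_one_mul _).symm)
    simp only [hB, h3, neg_one_mul, map_neg, neg_eq_zero, ← hBc,
      h.hemiSign_mul_of_halfNorm_eq_mul_i h1, hqχ]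
    rw [← hfin 0, ← hmain, ← h.sum_quadraticChar_mul_hemiSign, Finset.mul_sum]
    simp only [mul_ite, mul_zero]

end IsHemiData

end HemiSign

section TraceKernel

variable {K E : Type*} [Field K] [Fintype K] [Field E] [Fintype E] [Algebra K E]

theorem exists_eq_smul_add_smul_of_trace_eq_zero (hd : Module.finrank K E = 3) {ν β α : E}
    (hν0 : ν ≠ 0) (hν : Algebra.trace K E ν = 0) (hβ : Algebra.trace K E β = 0)
    (hα : Algebra.trace K E α = 0) (hβν : ∀ k : K, k • ν ≠ β) :
    ∃ s t : K, s • ν + t • β = α := by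
  have hker : Module.finrank K (LinearMap.ker (Algebra.trace K E)) = 2 := by
    have h1 := LinearMap.finrank_range_add_finrank_ker (Algebra.trace K E)
    rw [LinearMap.range_eq_top.2 (Algebra.trace_surjective K E), finrank_top, Module.finrank_self,
      hd] at h1
    omega
  have hle : Submodule.span K {ν, β} ≤ LinearMap.ker (Algebra.trace K E) := by
    rw [Submodule.span_le]
    rintro x (rfl | rfl)
    · exact hν
    · exact hβ
  have hli : LinearIndependent K ![ν, β] := (LinearIndependent.pair_iff' hν0).2 hβν
  have hspan : Module.finrank K (Submodule.span K {ν, β}) = 2 := by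
    have h1 := finrank_span_eq_card hli
    rwa [Matrix.range_cons, Matrix.range_cons, Matrix.range_empty, Set.union_empty,
      Set.singleton_union, Fintype.card_fin] at h1
  have heq := Submodule.eq_of_le_of_finrank_eq hle (hspan.trans hker.symm)
  have hmem : α ∈ Submodule.span K {ν, β} := by rw [heq]; exact hα
  exact Submodule.mem_span_pair.1 hmem

theorem exists_smul_eq_of_trace_div_eq_zero (hd : Module.finrank K E = 3) {ν μ : E}
    (hν0 : ν ≠ 0) (hν : Algebra.trace K E ν = 0) (hμ : Algebra.trace K E μ = 0)
    (h : Algebra.trace K E (μ * μ / ν) = 0) : ∃ k : K, k • ν = μ := by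
  by_contra! hcon
  obtain ⟨z₀, hz₀⟩ := Algebra.trace_surjective K E 1
  let k := Algebra.trace K E (μ / ν * z₀)
  have key : ∀ z, Algebra.trace K E ((μ / ν - algebraMap K E k) * z) = 0 := by
    intro z
    have hz : Algebra.trace K E (z - Algebra.trace K E z • z₀) = 0 := by
      rw [map_sub, map_smul, hz₀, smul_eq_mul, mul_one, sub_self]
    obtain ⟨s, t, hst⟩ := exists_eq_smul_add_smul_of_trace_eq_zero hd hν0 hν hμ hz hcon
    have h1 : (μ / ν - algebraMap K E k) * z = s • μ + t • (μ * μ / ν)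
        + Algebra.trace K E z • (μ / ν * z₀) - k • z := by
      generalize Algebra.trace K E z = τ at hst ⊢
      obtain rfl : z = s • ν + t • μ + τ • z₀ := sub_eq_iff_eq_add.1 hst.symm
      simp only [Algebra.smul_def]
      field_simp
    rw [h1]
    simp only [map_sub, map_add, map_smul, hμ, h, smul_eq_mul, k]
    ring
  by_cases h0 : μ / ν - algebraMap K E k = 0
  · apply hcon k
    rw [Algebra.smul_def, ← sub_eq_zero.1 h0, div_mul_cancel₀ _ hν0]
  · obtain ⟨z, hz⟩ := exists_trace_mul_ne_zero (K := K) h0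
    exact hz (key z)

theorem exists_smul_eq_of_trace_sq_add_sq_div_eq_zero (hK : Fintype.card K % 4 = 3)
    (hd : Module.finrank K E = 3) {ν α β : E} (hν0 : ν ≠ 0) (hν : Algebra.trace K E ν = 0)
    (hα : Algebra.trace K E α = 0) (hβ : Algebra.trace K E β = 0)
    (h : Algebra.trace K E ((α * α + β * β) / ν) = 0) :
    (∃ k : K, k • ν = α) ∧ ∃ l : K, l • ν = β := by
  have hβν : ∃ l : K, l • ν = β := by
    by_contra! hcon
    obtain ⟨s, t, rfl⟩ := exists_eq_smul_add_smul_of_trace_eq_zero hd hν0 hν hβ hα hcon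
    have h1 : ((s • ν + t • β) * (s • ν + t • β) + β * β) / ν =
        (s ^ 2) • ν + (2 * s * t) • β + (t ^ 2 + 1) • (β * β / ν) := by
      simp only [Algebra.smul_def, map_mul, map_add, map_pow, map_one, map_ofNat]
      field_simp
      ring
    rw [h1] at h
    simp only [map_add, map_smul, hν, hβ, zero_add, smul_eq_mul, mul_zero] at h
    rcases mul_eq_zero.1 h with h | h
    · refine FiniteField.isSquare_neg_one_iff.1 ⟨t, ?_⟩ hK
      linear_combination -h
    · obtain ⟨l, hl⟩ := exists_smul_eq_of_trace_div_eq_zero hd hν0 hν hβ h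
      exact hcon l hl
  refine ⟨?_, hβν⟩
  obtain ⟨l, rfl⟩ := hβν
  apply exists_smul_eq_of_trace_div_eq_zero hd hν0 hν hα
  have h1 : (α * α + l • ν * l • ν) / ν = α * α / ν + (l ^ 2) • ν := by
    simp only [Algebra.smul_def, map_pow]
    field_simp
  rwa [h1, map_add, map_smul, hν, smul_zero, add_zero] at h

end TraceKernel

section TotallySingular

variable {K E L : Type*} [Field K] [Fintype K] [Field E] [Fintype E] [Field L] [Fintype L]
  [Algebra K E] [Algebra E L] [Algebra K L] [IsScalarTower K E L]

namespace IsHemiData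

variable {sgn : E → ℤ} {ε : ℤ} {re im : L →ₗ[E] E} {i : L}

theorem polarForm_eq_zero_of_mem (h : IsHemiData K sgn ε re im i) {W : Submodule K L}
    (hW : ∀ x ∈ W, polarForm K re im x x = 0) {x y : L} (hx : x ∈ W) (hy : y ∈ W) :
    polarForm K re im x y = 0 := by
  have h1 := hW _ (W.add_mem hx hy)
  simp only [map_add, LinearMap.add_apply, hW x hx, hW y hy] at h1
  rw [polarForm_comm re im y x] at h1
  have h2 : 2 * polarForm K re im x y = 0 := by linear_combination h1
  simpa [FiniteField.two_ne_zero_of_card_mod_four h.card_mod_four] using h2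

theorem exists_eq_smul_add_smul (h : IsHemiData K sgn ε re im i) {v y : L} (hv0 : v ≠ 0)
    (hv : polarForm K re im v v = 0) (hy : polarForm K re im y y = 0)
    (hvy : polarForm K re im v y = 0) (hivy : polarForm K re im (i * v) y = 0) :
    ∃ k l : K, y = k • v + l • (i * v) := by
  have hg := h.isGaussian
  have hν0 : re v * re v + im v * im v ≠ 0 := by
    intro h0
    have h1 := hg.pow_card_add_one h.card_mod_four' v
    rw [h0, map_zero] at h1
    exact hv0 (pow_eq_zero_iff (Nat.succ_ne_zero _) |>.1 h1)
  rw [polarForm_apply] at hv hy hvy hivy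
  rw [hg.re_mul, hg.im_mul, hg.re_i, hg.im_i] at hivy
  have hβ : Algebra.trace K E (re v * im y - im v * re y) = 0 := by
    rw [← hivy]; congr 1; ring
  obtain ⟨⟨k, hk⟩, l, hl⟩ := exists_smul_eq_of_trace_sq_add_sq_div_eq_zero h.card_mod_four
    h.finrank_eq hν0 hv hvy hβ (by
      rw [← hy]
      congr 1
      rw [div_eq_iff hν0]
      ring)
  refine ⟨k, l, ?_⟩
  rw [Algebra.smul_def] at hk hl
  apply hg.ext
  · rw [map_add, LinearMap.map_smul_of_tower, LinearMap.map_smul_of_tower, hg.re_mul, hg.re_i,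
      hg.im_i, Algebra.smul_def, Algebra.smul_def]
    apply mul_left_cancel₀ hν0
    linear_combination (-re v) * hk + im v * hl
  · rw [map_add, LinearMap.map_smul_of_tower, LinearMap.map_smul_of_tower, hg.im_mul, hg.re_i,
      hg.im_i, Algebra.smul_def, Algebra.smul_def]
    apply mul_left_cancel₀ hν0
    linear_combination (-im v) * hk - re v * hl

theorem polarForm_i_mul_comm (h : IsHemiData K sgn ε re im i) (x y : L) :
    polarForm K re im (i * x) y = -polarForm K re im (i * y) x := by
  have hg := h.isGaussian
  rw [polarForm_apply, polarForm_apply, ← map_neg]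
  simp only [hg.re_mul, hg.im_mul, hg.re_i, hg.im_i]
  congr 1
  ring

theorem polarForm_i_mul_self (h : IsHemiData K sgn ε re im i) (x : L) :
    polarForm K re im (i * x) x = 0 := by
  have hg := h.isGaussian
  rw [polarForm_apply]
  simp only [hg.re_mul, hg.im_mul, hg.re_i, hg.im_i]
  rw [← map_zero (Algebra.trace K E)]
  congr 1
  ring

/-- The Witt index is two: there are no three independent mutually orthogonal isotropic vectors. -/
theorem not_linearIndependent (h : IsHemiData K sgn ε re im i) {x : Fin 3 → L}
    (hx : ∀ a b, polarForm K re im (x a) (x b) = 0) : ¬LinearIndependent K x := by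
  intro hli
  let ω : L → L → K := fun a b => polarForm K re im (i * a) b
  have hω1 : ∀ a, ω a a = 0 := h.polarForm_i_mul_self
  have hω2 : ∀ a b, ω a b = -ω b a := h.polarForm_i_mul_comm
  obtain ⟨c, hc0, hc⟩ : ∃ c : Fin 3 → K, c ≠ 0 ∧ ∀ b, ω (∑ a, c a • x a) (x b) = 0 := by
    have hsum : ∀ (c : Fin 3 → K) b, ω (∑ a, c a • x a) (x b) = ∑ a, c a * ω (x a) (x b) := by
      intro c b
      simp only [ω, Finset.mul_sum, mul_smul_comm, map_sum, map_smul, LinearMap.sum_apply,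
        LinearMap.smul_apply, smul_eq_mul]
    by_cases h0 : ω (x 1) (x 2) = 0 ∧ ω (x 2) (x 0) = 0 ∧ ω (x 0) (x 1) = 0
    · refine ⟨![1, 0, 0], fun h1 => by simpa using congrFun h1 0, fun b => ?_⟩
      rw [hsum]
      obtain ⟨h1, h2, h3⟩ := h0
      fin_cases b <;> simp [Fin.sum_univ_three, hω1, h3, hω2 (x 0) (x 2), h2]
    · refine ⟨![ω (x 1) (x 2), ω (x 2) (x 0), ω (x 0) (x 1)], fun h1 => h0 ?_, fun b => ?_⟩
      · exact ⟨by simpa using congrFun h1 0, by simpa using congrFun h1 1,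
          by simpa using congrFun h1 2⟩
      · rw [hsum]
        fin_cases b <;> simp [Fin.sum_univ_three, hω1]
        · rw [hω2 (x 1) (x 0)]; ring
        · rw [hω2 (x 2) (x 1)]; ring
        · rw [hω2 (x 0) (x 2)]; ring
  set v := ∑ a, c a • x a with hv
  have hv0 : v ≠ 0 := by
    intro h0
    exact hc0 (funext (Fintype.linearIndependent_iff.1 hli c h0))
  have hvx : ∀ b, polarForm K re im v (x b) = 0 := by
    intro b
    simp [hv, map_sum, LinearMap.sum_apply, hx]
  have hvv : polarForm K re im v v = 0 := by
    simp [hv, LinearMap.sum_apply, hx]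
  have hmem : ∀ b, x b ∈ Submodule.span K {v, i * v} := by
    intro b
    obtain ⟨k, l, hkl⟩ := h.exists_eq_smul_add_smul hv0 hvv (hx b b) (hvx b) (hc b)
    exact Submodule.mem_span_pair.2 ⟨k, l, hkl.symm⟩
  have hle : Submodule.span K (Set.range x) ≤ Submodule.span K {v, i * v} := by
    rw [Submodule.span_le]
    rintro _ ⟨b, rfl⟩
    exact hmem b
  have h3 := Submodule.finrank_mono hle
  rw [finrank_span_eq_card hli, Fintype.card_fin] at h3
  have h4 := finrank_span_finset_le_card (R := K) ({v, i * v} : Finset L)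
  have h5 := Finset.card_le_two (a := v) (b := i * v)
  rw [Set.finrank, Finset.coe_pair] at h4
  omega

theorem mem_of_polarForm_eq_zero (h : IsHemiData K sgn ε re im i) {W : Submodule K L}
    (hW2 : Module.finrank K W = 2) (hW : ∀ x ∈ W, polarForm K re im x x = 0) {x : L}
    (hx : polarForm K re im x x = 0) (hxW : ∀ w ∈ W, polarForm K re im w x = 0) : x ∈ W := by
  by_contra hxn
  let b := Module.finBasisOfFinrankEq K W hW2
  have hli : LinearIndependent K (fun a => (b a : L)) :=
    b.linearIndependent.map' W.subtype W.ker_subtype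
  have hspan : Submodule.span K (Set.range fun a => (b a : L)) ≤ W := by
    rw [Submodule.span_le]
    rintro _ ⟨a, rfl⟩
    exact (b a).2
  have hli3 := linearIndependent_finCons.2 ⟨hli, fun hmem => hxn (hspan hmem)⟩
  refine h.not_linearIndependent (fun a a' => ?_) hli3
  refine Fin.cases ?_ (fun a => ?_) a <;> refine Fin.cases ?_ (fun a' => ?_) a' <;>
    simp only [Fin.cons_zero, Fin.cons_succ]
  · exact hx
  · rw [polarForm_comm]
    exact hxW _ (b a').2
  · exact hxW _ (b a).2
  · exact h.polarForm_eq_zero_of_mem hW (b a).2 (b a').2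

theorem card_orthogonal (h : IsHemiData K sgn ε re im i) {W : Submodule K L}
    (hW2 : Module.finrank K W = 2) (hW : ∀ x ∈ W, polarForm K re im x x = 0) {x : L}
    (hx : polarForm K re im x x = 0) :
    ((Finset.univ.filter fun w : W => polarForm K re im w x = 0).card : ℤ) =
      Fintype.card K + if x ∈ W then (Fintype.card K : ℤ) ^ 2 - Fintype.card K else 0 := by
  have hcard : Fintype.card W = Fintype.card K ^ 2 := by
    rw [Module.card_eq_pow_finrank (K := K) (V := W), hW2]
  split_ifs with hxW
  · rw [Finset.filter_true_of_mem fun w _ => h.polarForm_eq_zero_of_mem hW w.2 hxW,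
      Finset.card_univ, hcard]
    push_cast
    ring
  · let g : W →ₗ[K] K := ((polarForm K re im).flip x).domRestrict W
    have hg : g ≠ 0 := by
      intro h0
      refine hxW (h.mem_of_polarForm_eq_zero hW2 hW hx fun w hw => ?_)
      exact LinearMap.congr_fun h0 (⟨w, hw⟩ : W)
    have h1 := card_fiber_mul_card g hg 0
    rw [hcard, sq] at h1
    have h2 := Nat.eq_of_mul_eq_mul_right Fintype.card_pos h1
    rw [add_zero]
    exact_mod_cast h2

theorem sum_hemiSign_submodule (h : IsHemiData K sgn ε re im i) {W : Submodule K L}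
    (hW2 : Module.finrank K W = 2) (hW : ∀ x ∈ W, polarForm K re im x x = 0) :
    ∑ w : W, hemiSign sgn re im (w : L) = 0 := by
  have h1 : ∑ w : W, ∑ x : L,
      (if polarForm K re im (w : L) x = 0 then hemiSign sgn re im x else 0) =
      ∑ w : W, -((Fintype.card K : ℤ) ^ 2 * (Fintype.card K - 1) * hemiSign sgn re im (w : L)) :=
    Finset.sum_congr rfl fun w _ => h.sum_hemiSign_orthogonal (hW w w.2)
  have h2 : ∀ x : L, ∑ w : W,
      (if polarForm K re im (w : L) x = 0 then hemiSign sgn re im x else 0) =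
      (Fintype.card K : ℤ) * hemiSign sgn re im x +
        ((Fintype.card K : ℤ) ^ 2 - Fintype.card K) *
          (if x ∈ W then hemiSign sgn re im x else 0) := by
    intro x
    by_cases hx : hemiSign sgn re im x = 0
    · simp [hx]
    · rw [← Finset.sum_filter, Finset.sum_const, nsmul_eq_mul,
        h.card_orthogonal hW2 hW ((h.hemiSign_ne_zero_iff x).1 hx).2]
      split_ifs <;> ring
  have h3 : ∑ x : L, (if x ∈ W then hemiSign sgn re im x else 0) =
      ∑ w : W, hemiSign sgn re im (w : L) := by
    rw [← Finset.sum_filter]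
    exact Finset.sum_subtype _ (by simp) _
  rw [Finset.sum_comm, Finset.sum_congr rfl (fun x _ => h2 x), Finset.sum_add_distrib,
    ← Finset.mul_sum, ← Finset.mul_sum, h.sum_hemiSign, h3, Finset.sum_neg_distrib,
    ← Finset.mul_sum] at h1
  have h4 : (Fintype.card K : ℤ) * (Fintype.card K ^ 2 - 1) *
      ∑ w : W, hemiSign sgn re im (w : L) = 0 := by linear_combination h1
  have h5 : (2 : ℤ) ≤ Fintype.card K := by exact_mod_cast Fintype.one_lt_card (α := K)
  refine (mul_eq_zero.1 h4).resolve_left (mul_ne_zero (by linarith) ?_)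
  nlinarith

end IsHemiData

end TotallySingular

section Counting

theorem two_mul_card_eq_one {α : Type*} [Fintype α] (f : α → ℤ) (hf : ∀ a, f a ≠ 0 → f a * f a = 1)
    (h0 : ∑ a, f a = 0) :
    2 * (Finset.univ.filter fun a => f a = 1).card = (Finset.univ.filter fun a => f a ≠ 0).card := by
  have h1 : ∀ a, f a + (if f a ≠ 0 then 1 else 0) = 2 * (if f a = 1 then 1 else 0) := by
    intro a
    by_cases ha : f a = 0
    · simp [ha]
    · rcases mul_self_eq_one_iff.1 (hf a ha) with h | h <;> simp [h]
  have h2 := Finset.sum_congr rfl fun a (_ : a ∈ Finset.univ) => h1 a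
  rw [Finset.sum_add_distrib, h0, zero_add, Finset.sum_boole, ← Finset.mul_sum,
    Finset.sum_boole] at h2
  exact_mod_cast h2.symm

/-- A set of nonzero vectors closed under nonzero scalars has `|K| - 1` elements for each line
it spans. -/
theorem card_image_span_singleton_mul {K V : Type*} [Field K] [Fintype K] [AddCommGroup V]
    [Module K V] (s : Finset V) (h0 : 0 ∉ s) (hs : ∀ k : K, k ≠ 0 → ∀ x ∈ s, k • x ∈ s) :
    (s.image fun x => Submodule.span K {x}).card * (Fintype.card K - 1) = s.card := by
  rw [Finset.card_eq_sum_card_image (fun x => Submodule.span K {x}) s, ← smul_eq_mul,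
    ← Finset.sum_const]
  refine Finset.sum_congr rfl fun P hP => ?_
  obtain ⟨x, hx, rfl⟩ := Finset.mem_image.1 hP
  have hx0 : x ≠ 0 := fun h => h0 (h ▸ hx)
  have h1 : s.filter (fun y => Submodule.span K {y} = Submodule.span K {x}) =
      Finset.univ.image fun u : Kˣ => u • x := by
    ext y
    rw [Finset.mem_filter, Finset.mem_image]
    constructor
    · rintro ⟨-, hy⟩
      obtain ⟨u, hu⟩ := Submodule.span_singleton_eq_span_singleton.1 hy.symm
      exact ⟨u, Finset.mem_univ u, hu⟩
    · rintro ⟨u, -, rfl⟩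
      exact ⟨hs u u.ne_zero x hx,
        (Submodule.span_singleton_eq_span_singleton.2 ⟨u, rfl⟩).symm⟩
  rw [h1, Finset.card_image_of_injective, Finset.card_univ, Fintype.card_units]
  intro u v huv
  exact Units.ext (smul_left_injective K hx0 huv)

theorem card_norm_eq {E L : Type*} [Field E] [Fintype E] [Field L] [Fintype L] [Algebra E L]
    (hL : Fintype.card L = Fintype.card E ^ 2) {c : E} (hc : c ≠ 0) :
    (Finset.univ.filter fun x : L => Algebra.norm E x = c).card = Fintype.card E + 1 := by
  have key : ∀ b : E, b ≠ 0 → (Finset.univ.filter fun x : L => Algebra.norm E x = b).card =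
      (Finset.univ.filter fun x : L => Algebra.norm E x = c).card := by
    intro b hb
    obtain ⟨z, hz⟩ := FiniteField.norm_surjective E L (c / b)
    have hz0 : z ≠ 0 := by
      rintro rfl
      rw [Algebra.norm_zero] at hz
      exact div_ne_zero hc hb hz.symm
    refine Finset.card_equiv (Equiv.mulLeft₀ z hz0) fun x => ?_
    simp only [Finset.mem_filter, Finset.mem_univ, true_and, Equiv.mulLeft₀_apply, map_mul, hz]
    rw [div_mul_eq_mul_div, div_eq_iff hb, mul_right_inj' hc]
  have hzero : (Finset.univ.filter fun x : L => Algebra.norm E x = 0).card = 1 := by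
    rw [Finset.card_eq_one]
    exact ⟨0, by ext x; simp [Algebra.norm_eq_zero_iff]⟩
  have h1 := Finset.card_eq_sum_card_fiberwise (s := (Finset.univ : Finset L)) (t := Finset.univ)
    (f := Algebra.norm E) (fun _ _ => Finset.mem_univ _)
  rw [Finset.card_univ, hL, ← Finset.add_sum_erase _ _ (Finset.mem_univ 0), hzero,
    Finset.sum_congr rfl (fun b hb => key b (Finset.ne_of_mem_erase hb)), Finset.sum_const,
    Finset.card_erase_of_mem (Finset.mem_univ 0), Finset.card_univ, smul_eq_mul] at h1
  have h2 := Fintype.one_lt_card (α := E)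
  obtain ⟨n, hn⟩ := Nat.exists_eq_add_of_lt h2
  rw [hn] at h1 ⊢
  have h3 : (n + 1) * (Finset.univ.filter fun x : L => Algebra.norm E x = c).card =
      (n + 1) * (1 + n + 1 + 1) := by
    have h4 : 1 + n + 1 - 1 = n + 1 := by omega
    rw [h4] at h1
    linarith
  exact Nat.eq_of_mul_eq_mul_left (Nat.succ_pos n) h3

theorem card_trace_norm_eq_zero {K E L : Type*} [Field K] [Fintype K] [Field E] [Fintype E]
    [Field L] [Fintype L] [Algebra K E] [Algebra E L] (hd : Module.finrank K E = 3)
    (hL : Fintype.card L = Fintype.card E ^ 2) :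
    (Finset.univ.filter fun x : L => x ≠ 0 ∧ Algebra.trace K E (Algebra.norm E x) = 0).card =
      (Fintype.card K ^ 3 + 1) * (Fintype.card K ^ 2 - 1) := by
  have hE : Fintype.card E = Fintype.card K ^ 3 := by
    rw [Module.card_eq_pow_finrank (K := K) (V := E), hd]
  have htr : Algebra.trace K E ≠ 0 := by
    intro h
    obtain ⟨z, hz⟩ := Algebra.trace_surjective K E 1
    rw [h] at hz
    exact zero_ne_one hz
  have h1 := card_fiber_mul_card (Algebra.trace K E) htr 0
  rw [hE, pow_succ] at h1
  have h2 := Nat.eq_of_mul_eq_mul_right Fintype.card_pos h1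
  rw [Finset.card_eq_sum_card_fiberwise
    (t := (Finset.univ.filter fun c : E => Algebra.trace K E c = 0).erase 0)
    (f := Algebra.norm E)]
  · have h3 : ∀ c ∈ (Finset.univ.filter fun c : E => Algebra.trace K E c = 0).erase 0,
        ((Finset.univ.filter fun x : L => x ≠ 0 ∧
          Algebra.trace K E (Algebra.norm E x) = 0).filter fun x => Algebra.norm E x = c).card =
        Fintype.card K ^ 3 + 1 := by
      intro c hc
      simp only [Finset.mem_erase, Finset.mem_filter, Finset.mem_univ, true_and] at hc
      rw [← hE, ← card_norm_eq hL hc.1]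
      congr 1
      ext x
      simp only [Finset.mem_filter, Finset.mem_univ, true_and]
      refine ⟨fun h => h.2, ?_⟩
      rintro rfl
      exact ⟨⟨fun h => hc.1 (by rw [h, Algebra.norm_zero]), hc.2⟩, rfl⟩
    rw [Finset.sum_congr rfl h3, Finset.sum_const, Finset.card_erase_of_mem (by simp), h2,
      smul_eq_mul, mul_comm]
  · intro x hx
    simp only [Finset.coe_filter, Finset.mem_univ, true_and, Set.mem_ofPred_eq] at hx
    simp [hx.1, hx.2, Algebra.norm_eq_zero_iff]

end Counting

section HemiPoints

variable {K E L : Type*} [Field K] [Fintype K] [Field E] [Fintype E] [Field L] [Fintype L]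
  [Algebra K E] [Algebra E L] [Algebra K L] [IsScalarTower K E L]

/-- The points of the hemisystem: the lines spanned by vectors of sign one. -/
noncomputable def hemiPoints (K : Type*) [Field K] [Algebra K L] (sgn : E → ℤ)
    (re im : L →ₗ[E] E) : Finset (Submodule K L) :=
  (Finset.univ.filter fun x => hemiSign sgn re im x = 1).image fun x => Submodule.span K {x}

namespace IsHemiData

variable {sgn : E → ℤ} {ε : ℤ} {re im : L →ₗ[E] E} {i : L}

theorem algebraMap_norm (h : IsHemiData K sgn ε re im i) (x : L) :
    algebraMap E L (Algebra.norm E x) = x ^ (Fintype.card E + 1) := by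
  have h1 := Fintype.one_lt_card (α := E)
  rw [FiniteField.algebraMap_norm_eq_pow, Nat.card_eq_fintype_card, Nat.card_eq_fintype_card,
    h.card_eq, ← one_pow 2, Nat.sq_sub_sq, one_pow, Nat.mul_div_cancel _ (Nat.sub_pos_of_lt h1)]

theorem polarForm_self (h : IsHemiData K sgn ε re im i) (x : L) :
    polarForm K re im x x = Algebra.trace K E (Algebra.norm E x) := by
  rw [polarForm_apply]
  congr 1
  apply (algebraMap E L).injective
  rw [h.algebraMap_norm, h.isGaussian.pow_card_add_one h.card_mod_four']

theorem polarForm_self_eq_zero_iff (h : IsHemiData K sgn ε re im i) (x : L) :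
    polarForm K re im x x = 0 ↔ x ^ (Fintype.card K ^ 3 + 1) +
      x ^ ((Fintype.card K ^ 3 + 1) * Fintype.card K) +
      x ^ ((Fintype.card K ^ 3 + 1) * Fintype.card K ^ 2) = 0 := by
  rw [← map_eq_zero (algebraMap K E), ← map_eq_zero (algebraMap E L), h.polarForm_self,
    FiniteField.algebraMap_trace_eq_sum_pow, h.finrank_eq, map_sum]
  simp only [map_pow, h.algebraMap_norm, h.card_eq_pow, Finset.sum_range_succ, Finset.sum_range_zero,
    Nat.card_eq_fintype_card, pow_zero, pow_one, zero_add, ← pow_mul, mul_one]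

theorem hemiSign_pow_card_sq (h : IsHemiData K sgn ε re im i) (x : L) :
    hemiSign sgn re im (x ^ (Fintype.card K ^ 2)) = hemiSign sgn re im x := by
  have hg := h.isGaussian
  let σ : E ≃ₐ[K] E := FiniteField.frobeniusAlgEquivOfAlgebraic K E ^ 2
  have hσ : ∀ c, σ c = c ^ (Fintype.card K ^ 2) := by
    intro c
    simp only [σ, AlgEquiv.coe_pow, FiniteField.coe_frobeniusAlgEquivOfAlgebraic, pow_iterate]
  have hσ3 : ∀ c, σ (σ (σ c)) = c := by
    intro c
    have h1 : Fintype.card K ^ 2 * (Fintype.card K ^ 2 * Fintype.card K ^ 2) =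
        Fintype.card E ^ 2 := by
      rw [h.card_eq_pow]; ring
    rw [hσ, hσ, hσ, ← pow_mul, ← pow_mul, h1, FiniteField.pow_card_pow]
  have hi : i ^ (Fintype.card K ^ 2) = i := by
    have h1 : Fintype.card K ^ 2 % 4 = 1 := by rw [Nat.pow_mod, h.card_mod_four]
    have h2 : i ^ 4 = 1 := by
      linear_combination (i * i - 1) * hg.mul_self
    rw [← Nat.div_add_mod (Fintype.card K ^ 2) 4, h1, pow_succ, pow_mul, h2, one_pow, one_mul]
  have hx : ∀ y : L, y ^ (Fintype.card K ^ 2) =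
      algebraMap E L (σ (re y)) + algebraMap E L (σ (im y)) * i := by
    intro y
    let τ : L →ₐ[K] L := FiniteField.frobeniusAlgHom K L ^ 2
    have hτ : ∀ z, τ z = z ^ (Fintype.card K ^ 2) := by
      intro z
      simp only [τ, AlgHom.coe_pow, FiniteField.coe_frobeniusAlgHom, pow_iterate]
    conv_lhs => rw [← hg.re_add_im y]
    rw [← hτ, map_add, map_mul, hτ, hτ, hτ, hi, hσ, hσ, map_pow, map_pow]
  rw [hemiSign, map_pow, hx, hg.re_mk, hg.im_mk, ← map_add, h.isConeSign.map_algEquiv σ hσ3,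
    hemiSign]

theorem hemiSign_mul_of_sq (h : IsHemiData K sgn ε re im i) {g : L}
    (hg : g ^ Fintype.card K = g) (hg0 : g ≠ 0) {a : L} (ha : halfNorm E a = g ^ 2) (x : L) :
    hemiSign sgn re im (a * x) = hemiSign sgn re im x := by
  obtain ⟨k, rfl⟩ : ∃ k, algebraMap K L k = g := by
    refine (IsGalois.mem_range_algebraMap_iff_fixed g).2 fun f => ?_
    obtain ⟨n, rfl⟩ := (FiniteField.bijective_frobeniusAlgEquivOfAlgebraic_pow K L).2 f
    change (FiniteField.frobeniusAlgEquivOfAlgebraic K L ^ (n : ℕ)) g = g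
    rw [AlgEquiv.coe_pow]
    exact Function.IsFixedPt.iterate hg _
  rw [← map_pow] at ha
  rw [h.hemiSign_mul_of_halfNorm ha, map_pow, quadraticChar_sq_one, one_mul]
  rintro rfl
  exact hg0 (map_zero _)

theorem span_singleton_mem_hemiPoints (h : IsHemiData K sgn ε re im i) (x : L) :
    Submodule.span K {x} ∈ hemiPoints K sgn re im ↔ hemiSign sgn re im x = 1 := by
  rw [hemiPoints, Finset.mem_image]
  constructor
  · rintro ⟨y, hy, hyx⟩
    obtain ⟨u, rfl⟩ := Submodule.span_singleton_eq_span_singleton.1 hyx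
    rw [Units.smul_def, h.hemiSign_smul u.ne_zero]
    exact (Finset.mem_filter.1 hy).2
  · intro hx
    exact ⟨x, by simpa using hx, rfl⟩

theorem finrank_of_mem_hemiPoints (h : IsHemiData K sgn ε re im i) {P : Submodule K L}
    (hP : P ∈ hemiPoints K sgn re im) :
    Module.finrank K P = 1 ∧ ∀ x ∈ P, polarForm K re im x x = 0 := by
  rw [hemiPoints, Finset.mem_image] at hP
  obtain ⟨x, hx, rfl⟩ := hP
  have hx1 : hemiSign sgn re im x = 1 := (Finset.mem_filter.1 hx).2
  have hx0 := (h.hemiSign_ne_zero_iff x).1 (by rw [hx1]; exact one_ne_zero)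
  refine ⟨finrank_span_singleton hx0.1, fun y hy => ?_⟩
  obtain ⟨k, rfl⟩ := Submodule.mem_span_singleton.1 hy
  simp [hx0.2]

theorem card_hemiPoints (h : IsHemiData K sgn ε re im i) :
    (hemiPoints K sgn re im).card = (Fintype.card K + 1) * (Fintype.card K ^ 3 + 1) / 2 := by
  have h1 := card_image_span_singleton_mul (K := K)
    (Finset.univ.filter fun x : L => hemiSign sgn re im x = 1)
    (by simp [h.hemiSign_zero]) (fun k hk x hx => by
      simpa [h.hemiSign_smul hk] using hx)
  have h2 := two_mul_card_eq_one (hemiSign sgn re im : L → ℤ) (fun _ => h.hemiSign_mul_self)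
    h.sum_hemiSign
  simp only [h.hemiSign_ne_zero_iff, h.polarForm_self] at h2
  rw [card_trace_norm_eq_zero h.finrank_eq h.card_eq, ← h1] at h2
  have h5 : Fintype.card K ^ 2 - 1 = (Fintype.card K + 1) * (Fintype.card K - 1) := by
    simpa using Nat.sq_sub_sq (Fintype.card K) 1
  have h3 : 0 < Fintype.card K - 1 := Nat.sub_pos_of_lt Fintype.one_lt_card
  have h4 : 2 * (hemiPoints K sgn re im).card =
      (Fintype.card K + 1) * (Fintype.card K ^ 3 + 1) := by
    apply Nat.eq_of_mul_eq_mul_right h3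
    rw [mul_assoc, hemiPoints]
    rw [h5] at h2
    linarith
  omega

theorem card_hemiPoints_le (h : IsHemiData K sgn ε re im i) {W : Submodule K L}
    (hW2 : Module.finrank K W = 2) (hW : ∀ x ∈ W, polarForm K re im x x = 0) :
    ((hemiPoints K sgn re im).filter fun P => P ≤ W).card = (Fintype.card K + 1) / 2 := by
  let s := Finset.univ.filter fun x : L => hemiSign sgn re im x = 1 ∧ x ∈ W
  have h1 := card_image_span_singleton_mul (K := K) s
    (by simp [s, h.hemiSign_zero]) (fun k hk x hx => by
      simp only [s, Finset.mem_filter, Finset.mem_univ, true_and] at hx ⊢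
      exact ⟨by rw [h.hemiSign_smul hk, hx.1], W.smul_mem k hx.2⟩)
  have himg : s.image (fun x => Submodule.span K {x}) =
      (hemiPoints K sgn re im).filter fun P => P ≤ W := by
    ext P
    simp only [s, hemiPoints, Finset.mem_image, Finset.mem_filter, Finset.mem_univ, true_and]
    constructor
    · rintro ⟨x, ⟨hx, hxW⟩, rfl⟩
      exact ⟨⟨x, hx, rfl⟩, (Submodule.span_singleton_le_iff_mem x W).2 hxW⟩
    · rintro ⟨⟨x, hx, rfl⟩, hxW⟩
      exact ⟨x, ⟨hx, (Submodule.span_singleton_le_iff_mem x W).1 hxW⟩, rfl⟩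
  have h2 := two_mul_card_eq_one (fun w : W => hemiSign sgn re im (w : L))
    (fun _ => h.hemiSign_mul_self) (h.sum_hemiSign_submodule hW2 hW)
  have hs : (Finset.univ.filter fun w : W => hemiSign sgn re im (w : L) = 1).card = s.card := by
    rw [← Finset.card_map (Function.Embedding.subtype (· ∈ W))]
    congr 1
    ext x
    simp [s, and_comm]
  have hne : (Finset.univ.filter fun w : W => hemiSign sgn re im (w : L) ≠ 0).card =
      Fintype.card K ^ 2 - 1 := by
    have h3 : (Finset.univ.filter fun w : W => hemiSign sgn re im (w : L) ≠ 0) =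
        Finset.univ.erase 0 := by
      ext w
      simp [h.hemiSign_ne_zero_iff, hW w w.2]
    rw [h3, Finset.card_erase_of_mem (Finset.mem_univ 0), Finset.card_univ,
      Module.card_eq_pow_finrank (K := K) (V := W), hW2]
  rw [hs, hne, ← h1, himg, ← one_pow 2, Nat.sq_sub_sq, one_pow] at h2
  have h3 : 0 < Fintype.card K - 1 := Nat.sub_pos_of_lt Fintype.one_lt_card
  have h4 : 2 * ((hemiPoints K sgn re im).filter fun P => P ≤ W).card = Fintype.card K + 1 := by
    apply Nat.eq_of_mul_eq_mul_right h3
    linarith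
  omega

end IsHemiData

end HemiPoints

theorem exists_intermediateField_finrank_eq_three {K L : Type*} [Field K] [Fintype K] [Field L]
    [Fintype L] [Algebra K L] (h : Module.finrank K L = 6) :
    ∃ E : IntermediateField K L, Module.finrank K E = 3 ∧ Module.finrank E L = 2 := by
  let φ := FiniteField.frobeniusAlgEquivOfAlgebraic K L
  let E : IntermediateField K L := IntermediateField.fixedField (Subgroup.zpowers (φ ^ 3))
  have h2 : Module.finrank E L = 2 := by
    rw [IntermediateField.finrank_fixedField_eq_card, Nat.card_zpowers,
      orderOf_pow' _ (by decide), FiniteField.orderOf_frobeniusAlgEquivOfAlgebraic, h]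
    rfl
  refine ⟨E, ?_, h2⟩
  have h3 := Module.finrank_mul_finrank K E L
  rw [h, h2] at h3
  omega

theorem exists_isHemiData {K L : Type} [Field K] [Fintype K] [Field L] [Fintype L] [Algebra K L]
    (hK : Fintype.card K % 4 = 3) (hL : Fintype.card L = Fintype.card K ^ 6) :
    ∃ (E : IntermediateField K L) (sgn : E → ℤ) (ε : ℤ) (re im : L →ₗ[E] E) (i : L),
      IsHemiData K sgn ε re im i := by
  have h6 : Module.finrank K L = 6 := by
    rw [Module.card_eq_pow_finrank (K := K) (V := L)] at hL
    exact Nat.pow_right_injective Fintype.one_lt_card hL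
  obtain ⟨E, h3, h2⟩ := exists_intermediateField_finrank_eq_three h6
  have hcE : Fintype.card E = Fintype.card K ^ 3 := by
    rw [Module.card_eq_pow_finrank (K := K) (V := E), h3]
  have hE : Fintype.card E % 4 = 3 := by rw [hcE, Nat.pow_mod, hK]
  have hLE : Fintype.card L = Fintype.card E ^ 2 := by
    rw [Module.card_eq_pow_finrank (K := E) (V := L), h2]
  obtain ⟨sgn, ε, hsgn⟩ := exists_isConeSign (K := K) hK hE h3
  obtain ⟨re, im, i, hg⟩ := exists_isGaussian hE hLE
  exact ⟨E, sgn, ε, re, im, i, hsgn, hg, hK, h3, hLE⟩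

/-- **Theorem 1.1 with its symmetry group.** For every prime power `q ≡ 3 (mod 4)` and every
generator `γ` of `F_{q^6}^×`, there is a `(q+1)/2`-ovoid of `Q⁻(5,q)` (modelled in `F_{q^6}`
with `Q(x) = Tr_{q^3/q}(x^{q^3+1})`) stabilized by multiplication by `γ^{4(q^2+q+1)}` and by
the map `v ↦ v^{q^2}`, inducing a group `C_{(q^3+1)/4} : C_3`. -/
theorem hemisystem_exists_with_group
    (q : ℕ) (hq : IsPrimePow q) (hq4 : q % 4 = 3)
    (K L : Type) [Field K] [Fintype K] [Field L] [Fintype L] [Algebra K L]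
    (hK : Fintype.card K = q) (hL : Fintype.card L = q ^ 6)
    (γ : Lˣ) (hγ : ∀ x : Lˣ, x ∈ Subgroup.zpowers γ) :
    ∃ M : Set (Submodule K L),
      (∀ P ∈ M, Module.finrank K P = 1 ∧
        ∀ x ∈ P, x ^ (q ^ 3 + 1) + x ^ ((q ^ 3 + 1) * q) + x ^ ((q ^ 3 + 1) * q ^ 2) = 0) ∧
      M.ncard = (q + 1) * (q ^ 3 + 1) / 2 ∧
      (∀ W : Submodule K L, Module.finrank K W = 2 →
        (∀ x ∈ W, x ^ (q ^ 3 + 1) + x ^ ((q ^ 3 + 1) * q) + x ^ ((q ^ 3 + 1) * q ^ 2) = 0) →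
        {P ∈ M | P ≤ W}.ncard = (q + 1) / 2) ∧
      (∀ v : L, Submodule.span K {v} ∈ M →
        Submodule.span K {((γ : L) ^ (4 * (q ^ 2 + q + 1))) * v} ∈ M) ∧
      (∀ v : L, Submodule.span K {v} ∈ M → Submodule.span K {v ^ (q ^ 2)} ∈ M) := by
  subst hK
  obtain ⟨E, sgn, ε, re, im, i, h⟩ := exists_isHemiData hq4 hL
  refine ⟨hemiPoints K sgn re im, ?_, ?_, ?_, ?_, ?_⟩
  · intro P hP
    simp only [← h.polarForm_self_eq_zero_iff]
    exact h.finrank_of_mem_hemiPoints hP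
  · rw [Set.ncard_coe_finset, h.card_hemiPoints]
  · intro W hW2 hW
    simp only [← h.polarForm_self_eq_zero_iff] at hW
    rw [← h.card_hemiPoints_le hW2 hW, ← Set.ncard_coe_finset]
    congr 1
    ext P
    simp
  · intro v hv
    rw [Finset.mem_coe, h.span_singleton_mem_hemiPoints] at hv ⊢
    rw [← hv]
    refine h.hemiSign_mul_of_sq
      (g := (γ : L) ^ ((Fintype.card K ^ 2 + Fintype.card K + 1) * (Fintype.card K ^ 3 + 1)))
      ?_ (pow_ne_zero _ γ.ne_zero) ?_ v
    · have h1 := FiniteField.pow_card (γ : L)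
      have h2 : (Fintype.card K ^ 2 + Fintype.card K + 1) * (Fintype.card K ^ 3 + 1) *
          Fintype.card K + 1 = Fintype.card L +
          (Fintype.card K ^ 2 + Fintype.card K + 1) * (Fintype.card K ^ 3 + 1) := by
        rw [hL]; ring
      apply mul_right_cancel₀ γ.ne_zero
      rw [← pow_mul, ← pow_succ, h2, pow_add, h1, mul_comm]
    · rw [halfNorm_apply, h.card_eq_pow, ← pow_mul, ← pow_mul]
      have h3 : 2 ∣ Fintype.card K ^ 3 + 1 := by
        have := h.card_mod_four'
        rw [h.card_eq_pow] at this
        omega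
      obtain ⟨m, hm⟩ := h3
      rw [hm, Nat.mul_div_cancel_left m two_pos]
      congr 1
      ring
  · intro v hv
    rw [Finset.mem_coe, h.span_singleton_mem_hemiPoints] at hv ⊢
    rw [h.hemiSign_pow_card_sq, hv]
end
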